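/- Let G be a finitely presented group and N a normal subgroup with G' ≤ N. Assume there exists a finitely generated subgroup H with N ≤ H ≤ G such that rk G/N ≤ 2·rk G/H. Then there exists an automorphism μ of G/N such that the twisted N-fibre product H_μ = {(g₁,g₂) ∈ G × G : μ(g₁N) = g₂N} is finitely presented. -/

import Mathlib

/-- A group is finitely presented if it is the quotient of a finitely generated free group
by the normal closure of finitely many relators. -/
def FinitelyPresentedGroup (G : Type*) [Group G] : Prop :=
  ∃ (n : ℕ) (f : FreeGroup (Fin n) →* G) (S : Finset (FreeGroup (Fin n))),
    Function.Surjective f ∧ f.ker = Subgroup.normalClosure (S : Set (FreeGroup (Fin n)))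

/-- The torsion-free rank of the abelianization of `G`, i.e. `rk G/G'`. -/
noncomputable def rkAb (G : Type*) [Group G] : ℕ :=
  Module.finrank ℤ (Additive (Abelianization G))

/-- The torsion-free rank of the quotient `G ⧸ K` (for `K` a normal subgroup). -/
noncomputable def rkQuot {G : Type*} [Group G] (K : Subgroup G) (hK : K.Normal) : ℕ :=
  letI := hK
  rkAb (G ⧸ K)

/-- The fibre product associated to an isomorphism `μ : G₁⧸N₁ ≃* G₂⧸N₂`. -/
def fibreProduct {G₁ G₂ : Type*} [Group G₁] [Group G₂]
    (N₁ : Subgroup G₁) (N₂ : Subgroup G₂) [N₁.Normal] [N₂.Normal]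
    (μ : (G₁ ⧸ N₁) ≃* (G₂ ⧸ N₂)) : Subgroup (G₁ × G₂) where
  carrier := {p | μ (QuotientGroup.mk p.1) = QuotientGroup.mk p.2}
  one_mem' := by simp
  mul_mem' := by
    intro a b ha hb
    simp only [Set.mem_setOf_eq] at *
    rw [Prod.fst_mul, Prod.snd_mul, QuotientGroup.mk_mul, QuotientGroup.mk_mul, map_mul, ha, hb]
  inv_mem' := by
    intro a ha
    simp only [Set.mem_setOf_eq] at *
    rw [Prod.fst_inv, Prod.snd_inv, QuotientGroup.mk_inv, QuotientGroup.mk_inv, map_inv, ha]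

namespace TFP
open scoped commutatorElement


/-- value of a word -/
def wv {Γ β : Type*} [Group Γ] (val : β → Γ) (w : List β) : Γ := (w.map val).prod

/-- subgroup generated by the conjugates of `T` by words in `W` -/
def cl {Γ β : Type*} [Group Γ] (val : β → Γ) (T : Subgroup Γ) (W : Set (List β)) : Subgroup Γ :=
  Subgroup.closure {x | ∃ w ∈ W, ∃ t ∈ T, x = wv val w * t * (wv val w)⁻¹}

section
variable {Γ β : Type*} [Group Γ] (val : β → Γ)

@[simp] lemma wv_nil : wv val [] = 1 := by simp [wv]
@[simp] lemma wv_cons (b : β) (w : List β) : wv val (b :: w) = val b * wv val w := by simp [wv]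
@[simp] lemma wv_append (u w : List β) : wv val (u ++ w) = wv val u * wv val w := by simp [wv]
@[simp] lemma wv_replicate (n : ℕ) (b : β) : wv val (List.replicate n b) = val b ^ n := by simp [wv]

lemma wv_inv (inv : β → β) (hinv : ∀ b, val (inv b) = (val b)⁻¹) (w : List β) :
    wv val ((w.map inv).reverse) = (wv val w)⁻¹ := by
  induction w with
  | nil => simp
  | cons b w ih => simp [ih, hinv]

lemma cl_mono (T : Subgroup Γ) {W W' : Set (List β)} (h : W ⊆ W') : cl val T W ≤ cl val T W' := by
  apply Subgroup.closure_mono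
  rintro x ⟨w, hw, t, ht, rfl⟩
  exact ⟨w, h hw, t, ht, rfl⟩

lemma mem_cl (T : Subgroup Γ) {W : Set (List β)} {w : List β} (hw : w ∈ W) {t : Γ} (ht : t ∈ T) :
    wv val w * t * (wv val w)⁻¹ ∈ cl val T W :=
  Subgroup.subset_closure ⟨w, hw, t, ht, rfl⟩

lemma le_cl (T : Subgroup Γ) {W : Set (List β)} (hw : [] ∈ W) : T ≤ cl val T W := by
  intro t ht
  simpa using mem_cl val T hw ht

lemma cl_map {Δ : Type*} [Group Δ] (f : Γ →* Δ) (T : Subgroup Γ) (W : Set (List β)) :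
    (cl val T W).map f = cl (f ∘ val) (T.map f) W := by
  have hw : ∀ w : List β, wv (f ∘ val) w = f (wv val w) := by
    intro w; simp [wv, map_list_prod]
  unfold cl
  rw [MonoidHom.map_closure]
  congr 1
  ext x
  constructor
  · rintro ⟨_, ⟨w, hW, t, ht, rfl⟩, rfl⟩
    exact ⟨w, hW, f t, ⟨t, ht, rfl⟩, by simp [hw]⟩
  · rintro ⟨w, hW, _, ⟨t, ht, rfl⟩, rfl⟩
    exact ⟨_, ⟨w, hW, t, ht, rfl⟩, by simp [hw]⟩

/-- closure-commuting -/
lemma commute_closure {S S' : Set Γ} (h : ∀ x ∈ S, ∀ y ∈ S', Commute x y) {x y : Γ}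
    (hx : x ∈ Subgroup.closure S) (hy : y ∈ Subgroup.closure S') : Commute x y := by
  have h1 : Subgroup.closure S ≤ Subgroup.centralizer (Subgroup.closure S' : Set Γ) := by
    rw [Subgroup.closure_le, Subgroup.centralizer_closure]
    intro x hx
    rw [SetLike.mem_coe, Subgroup.mem_centralizer_iff]
    intro y hy
    exact (h x hx y hy).symm.eq
  have := h1 hx
  rw [Subgroup.mem_centralizer_iff] at this
  exact (this y hy).symm

lemma commute_conj_iff (g x y : Γ) : Commute (g * x * g⁻¹) (g * y * g⁻¹) ↔ Commute x y :=
  ⟨fun h => by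
    have := h.eq
    simp only [commute_iff_eq] at *
    have h2 : g * (x * y) * g⁻¹ = g * (y * x) * g⁻¹ := by
      calc _ = (g * x * g⁻¹) * (g * y * g⁻¹) := by group
        _ = _ := this
        _ = _ := by group
    simpa using h2,
   fun h => by
    simp only [commute_iff_eq] at *
    calc (g * x * g⁻¹) * (g * y * g⁻¹) = g * (x * y) * g⁻¹ := by group
      _ = g * (y * x) * g⁻¹ := by rw [h]
      _ = _ := by group⟩

/-- `x` conjugates `R` into the centralizer of `L` -/
def Com (L R : Subgroup Γ) (x : Γ) : Prop := ∀ l ∈ L, ∀ r ∈ R, Commute l (x * r * x⁻¹)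

lemma commute_cl (inv : β → β) (hinv : ∀ b, val (inv b) = (val b)⁻¹) (L R : Subgroup Γ) (D m n : ℕ)
    (hC : ∀ w : List β, w.length ≤ D → Com L R (wv val w)) (w : List β) (hw : m + w.length + n ≤ D)
    {x y : Γ} (hx : x ∈ cl val L {w | w.length ≤ m}) (hy : y ∈ cl val R {w | w.length ≤ n}) :
    Commute x (wv val w * y * (wv val w)⁻¹) := by
  have hy' : wv val w * y * (wv val w)⁻¹ ∈ (cl val R {w | w.length ≤ n}).map
      (MulAut.conj (wv val w)).toMonoidHom := ⟨y, hy, by simp⟩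
  unfold cl at hy'
  rw [MonoidHom.map_closure] at hy'
  refine commute_closure ?_ hx hy'
  rintro _ ⟨u, hu, l, hl, rfl⟩ _ ⟨_, ⟨v, hv, r, hr, rfl⟩, rfl⟩
  simp only [Set.mem_ofPred_eq] at hu hv
  have := hC ((u.map inv).reverse ++ w ++ v) (by simp; omega) l hl r hr
  rw [← commute_conj_iff (wv val u)] at this
  convert this using 1
  simp only [wv_append, wv_inv val inv hinv]
  simp [mul_assoc]

lemma com_swap (L R : Subgroup Γ) (D : ℕ)
    (hsw : ∀ b b', ∃ l ∈ L, ∃ r ∈ R, val b * val b' = l * r * (val b' * val b))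
    (hC : ∀ w : List β, w.length ≤ D → Com L R (wv val w)) (u v : List β) (b b' : β)
    (hlen : (u ++ b :: b' :: v).length ≤ D + 1) (h : Com L R (wv val (u ++ b' :: b :: v))) :
    Com L R (wv val (u ++ b :: b' :: v)) := by
  intro l hl r hr
  obtain ⟨l', hl', r', hr', he⟩ := hsw b b'
  have hs : Com L R (wv val (b' :: b :: v)) := by
    cases u with
    | nil => simpa using h
    | cons x u => apply hC; simp at hlen ⊢; omega
  have hu : Com L R (wv val u) := hC u (by simp at hlen; omega)
  have h1 : Commute l' (wv val (b' :: b :: v) * r * (wv val (b' :: b :: v))⁻¹) := hs l' hl' r hr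
  have h2 : Commute l' r' := by simpa using hC [] (by simp) l' hl' r' hr'
  set g := wv val (b' :: b :: v) * r * (wv val (b' :: b :: v))⁻¹ with hg
  have h3 : wv val (u ++ b :: b' :: v) * r * (wv val (u ++ b :: b' :: v))⁻¹ =
      (wv val u * r' * (wv val u)⁻¹) * (wv val (u ++ b' :: b :: v) * r * (wv val (u ++ b' :: b :: v))⁻¹)
        * (wv val u * r' * (wv val u)⁻¹)⁻¹ := by
    have e1 : wv val (b :: b' :: v) = l' * r' * wv val (b' :: b :: v) := by
      simp only [wv_cons, ← mul_assoc]; rw [he]; simp [mul_assoc]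
    have e2 : wv val (b :: b' :: v) * r * (wv val (b :: b' :: v))⁻¹ = r' * g * r'⁻¹ := by
      rw [e1]
      calc _ = l' * (r' * g * r'⁻¹) * l'⁻¹ := by rw [hg]; group
        _ = _ := by
          have : Commute l' (r' * g * r'⁻¹) := (h2.mul_right h1).mul_right h2.inv_right
          rw [this.eq]; group
    rw [wv_append, wv_append]
    calc _ = wv val u * (wv val (b :: b' :: v) * r * (wv val (b :: b' :: v))⁻¹) * (wv val u)⁻¹ := by group
      _ = wv val u * (r' * g * r'⁻¹) * (wv val u)⁻¹ := by rw [e2]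
      _ = _ := by rw [hg]; group
  rw [h3]
  have hc := hu l hl r' hr'
  exact (hc.mul_right (h l hl r hr)).mul_right hc.inv_right

lemma com_perm (L R : Subgroup Γ) (D : ℕ)
    (hsw : ∀ b b', ∃ l ∈ L, ∃ r ∈ R, val b * val b' = l * r * (val b' * val b))
    (hC : ∀ w : List β, w.length ≤ D → Com L R (wv val w)) {w w' : List β} (hp : w.Perm w') :
    ∀ u : List β, (u ++ w).length ≤ D + 1 → Com L R (wv val (u ++ w)) → Com L R (wv val (u ++ w')) := by
  induction hp with
  | nil => intro u _ h; exact h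
  | cons x hp ih =>
    intro u hl h
    have := ih (u ++ [x]) (by simp at hl ⊢; omega) (by simpa using h)
    simpa using this
  | swap x y l =>
    intro u hl h
    exact com_swap val L R D hsw hC u l x y (by simpa using hl) h
  | trans p q ih1 ih2 =>
    intro u hl h
    refine ih2 u ?_ (ih1 u hl h)
    rw [List.length_append, ← p.length_eq]; simpa using hl

theorem lemA [Fintype β] [DecidableEq β] (inv : β → β)
    (hinv : ∀ b, val (inv b) = (val b)⁻¹) (L R : Subgroup Γ) (c e : ℕ) (he : 2 * c + 1 ≤ e)
    (hsw : ∀ b b', ∃ l ∈ L, ∃ r ∈ R, val b * val b' = l * r * (val b' * val b))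
    (κ : β → Γ)
    (h1 : ∀ b, ∀ l ∈ L, (κ b * (val b ^ e)⁻¹) * l * (κ b * (val b ^ e)⁻¹)⁻¹ ∈ cl val L {w | w.length ≤ c})
    (h2 : ∀ b, ∀ r ∈ R, κ b * r * (κ b)⁻¹ ∈ cl val R {w | w.length ≤ c})
    (h3 : ∀ b b', ∃ l ∈ cl val L {w | w.length ≤ c + e}, ∃ r ∈ cl val R {w | w.length ≤ c},
      κ b * val b' * (κ b)⁻¹ = val b' * l * r)
    (h3' : ∀ b, ∃ l ∈ cl val L {w | w.length ≤ c}, ∃ r ∈ cl val R {w | w.length ≤ c},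
      κ b * val b * (κ b)⁻¹ = val b * l * r)
    (h0 : ∀ w : List β, w.length ≤ Fintype.card β * (e + 2 * c) → Com L R (wv val w)) (w : List β) :
    Com L R (wv val w) := by
  suffices H : ∀ D, Fintype.card β * (e + 2 * c) ≤ D →
      ∀ w : List β, w.length ≤ D → Com L R (wv val w) from
    H (max (Fintype.card β * (e + 2 * c)) w.length) (le_max_left _ _) w (le_max_right _ _)
  intro D hD
  induction D, hD using Nat.le_induction with
  | base => exact h0
  | succ D hD ih =>
    intro w hw
    rcases Nat.lt_or_ge w.length (D + 1) with hlt | hge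
    · exact ih w (by omega)
    have hlen : w.length = D + 1 := le_antisymm hw hge
    -- pigeonhole
    obtain ⟨b, hb⟩ : ∃ b, e + 2 * c ≤ w.count b := by
      by_contra hcon
      push Not at hcon
      have : w.length = ∑ b : β, w.count b := by
        have := Multiset.sum_count_eq_card (s := Finset.univ) (m := (w : Multiset β)) (by simp)
        simpa using this.symm
      have h' : ∑ b : β, w.count b ≤ ∑ b : β, (e + 2 * c) := Finset.sum_le_sum fun b _ => (hcon b).le
      simp at h'
      omega
    obtain ⟨q', hq'⟩ : ∃ q', w.Perm (List.replicate e b ++ (List.replicate (2 * c) b ++ q')) := by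
      have hs : List.Sublist (List.replicate (e + 2 * c) b) w := List.replicate_sublist_iff.mpr hb
      obtain ⟨q', hq'⟩ := hs.exists_perm_append
      exact ⟨q', by rw [← List.append_assoc, List.replicate_append_replicate]; exact hq'⟩
    have hlen' := hq'.length_eq
    simp only [List.length_append, List.length_replicate] at hlen'
    suffices Com L R (wv val (List.replicate e b ++ (List.replicate (2 * c) b ++ q'))) by
      have := com_perm val L R D hsw ih hq'.symm [] (by simp; omega) (by simpa using this)
      simpa using this
    intro l hl r hr
    set q := List.replicate (2 * c) b ++ q' with hq
    have hql : q.length = 2 * c + q'.length := by simp [hq]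
    -- the subgroup of right elements
    let RR : List β → Subgroup Γ := fun q2 => Subgroup.closure
      {x | ∃ u v, u ++ v = q2 ∧ ∃ ρ ∈ cl val R {w | w.length ≤ c}, x = wv val u * ρ * (wv val u)⁻¹}
    have hcomm : ∀ (m : ℕ) (q2 : List β), m + q2.length + c ≤ D → ∀ x ∈ cl val L {w | w.length ≤ m},
        ∀ y ∈ RR q2, Commute x y := by
      intro m q2 hm x hx y hy
      have hx' : x ∈ Subgroup.closure {x} := Subgroup.subset_closure rfl
      refine commute_closure ?_ hx' hy
      rintro _ rfl _ ⟨u, v, huv, ρ, hρ, rfl⟩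
      refine commute_cl val inv hinv L R D m c ih u ?_ hx hρ
      rw [← huv] at hm; simp at hm; omega
    have key : ∀ q2 q1 : List β, q1 ++ q2 = q →
        (κ b * wv val q2 * (κ b)⁻¹) * (κ b * r * (κ b)⁻¹) * (κ b * wv val q2 * (κ b)⁻¹)⁻¹ ∈ RR q2 := by
      intro q2
      induction q2 with
      | nil =>
        intro q1 _
        refine Subgroup.subset_closure ⟨[], [], rfl, _, h2 b r hr, by simp⟩
      | cons b' q2 ihq =>
        intro q1 hq1
        have ih1 := ihq (q1 ++ [b']) (by simpa using hq1)
        set X := (κ b * wv val q2 * (κ b)⁻¹) * (κ b * r * (κ b)⁻¹) * (κ b * wv val q2 * (κ b)⁻¹)⁻¹ with hX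
        have hqq : q1.length + (1 + q2.length) = q.length := by rw [← hq1]; simp; omega
        obtain ⟨lam, rho, hlam, hrho, heq⟩ : ∃ lam rho, (∀ y ∈ RR q2, Commute lam y) ∧
            rho ∈ cl val R {w | w.length ≤ c} ∧ κ b * val b' * (κ b)⁻¹ = val b' * lam * rho := by
          rcases Nat.lt_or_ge q1.length (2 * c) with hlt | hge
          · have hb' : b' = b := by
              have h4 : q[q1.length]? = some b' := by rw [← hq1]; simp
              rw [hq, List.getElem?_append_left (by simpa using hlt)] at h4
              rw [List.getElem?_replicate] at h4
              simp [hlt] at h4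
              exact h4.symm
            subst hb'
            obtain ⟨lam, hlam, rho, hrho, heq⟩ := h3' b'
            exact ⟨lam, rho, hcomm c q2 (by omega) lam hlam, hrho, heq⟩
          · obtain ⟨lam, hlam, rho, hrho, heq⟩ := h3 b b'
            exact ⟨lam, rho, hcomm (c + e) q2 (by omega) lam hlam, hrho, heq⟩
        have hrho' : rho ∈ RR q2 := Subgroup.subset_closure ⟨[], q2, rfl, rho, hrho, by simp⟩
        have hY : rho * X * rho⁻¹ ∈ RR q2 := (RR q2).mul_mem ((RR q2).mul_mem hrho' ih1) ((RR q2).inv_mem hrho')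
        have hexp : (κ b * wv val (b' :: q2) * (κ b)⁻¹) * (κ b * r * (κ b)⁻¹) *
            (κ b * wv val (b' :: q2) * (κ b)⁻¹)⁻¹ = val b' * (rho * X * rho⁻¹) * (val b')⁻¹ := by
          have hc := (hlam _ hY).eq
          calc _ = (κ b * val b' * (κ b)⁻¹) * X * (κ b * val b' * (κ b)⁻¹)⁻¹ := by
                rw [hX, wv_cons]; group
            _ = val b' * (lam * (rho * X * rho⁻¹)) * lam⁻¹ * (val b')⁻¹ := by rw [heq]; group
            _ = _ := by rw [hc]; group
        rw [hexp]
        have : val b' * (rho * X * rho⁻¹) * (val b')⁻¹ ∈ (RR q2).map (MulAut.conj (val b')).toMonoidHom :=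
          ⟨_, hY, by simp⟩
        refine (?_ : (RR q2).map (MulAut.conj (val b')).toMonoidHom ≤ RR (b' :: q2)) this
        rw [Subgroup.map_le_iff_le_comap, Subgroup.closure_le]
        rintro _ ⟨u, v, huv, ρ, hρ, rfl⟩
        refine Subgroup.subset_closure ⟨b' :: u, v, by simp [huv], ρ, hρ, ?_⟩
        simp [mul_assoc]
    have hk := key q [] rfl
    have hfin := hcomm c q (by omega) _ (h1 b l hl) _ hk
    rw [wv_append, wv_replicate]
    rw [← commute_conj_iff (κ b * (val b ^ e)⁻¹)]
    convert hfin using 1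
    group
end


theorem fng_of_le {E : Type*} [Group E] [Group.FG E] (B Z : Subgroup E) [hBn : B.Normal] (hZn : Z.Normal)
    (hB : ∀ x ∈ B, ∀ y ∈ B, x * y = y * x)
    (hact : ∀ g ∈ commutator E, ∀ b ∈ B, g * b * g⁻¹ = b)
    (hfg : B.IsFinitelyNormallyGenerated) (hZ : Z ≤ B) : Z.IsFinitelyNormallyGenerated := by
  classical
  let : CommGroup B := { (inferInstance : Group B) with
    mul_comm := fun x y => Subtype.ext (hB x x.2 y y.2) }
  let ρ0 : E →* Module.End ℤ (Additive B) :=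
    { toFun := fun g => (MonoidHom.toAdditive (MulAut.conjNormal g : MulAut B).toMonoidHom).toIntLinearMap
      map_one' := by ext x; simp
      map_mul' := by intro a b; ext x; simp }
  have hρ0 : ∀ g (b : Additive B), ((ρ0 g b).toMul : E) = g * (b.toMul : E) * g⁻¹ := by
    intro g b
    exact MulAut.conjNormal_apply g b.toMul
  let ρ : Representation ℤ (Abelianization E) (Additive B) :=
    QuotientGroup.lift (commutator E) ρ0 (by
      intro g hg
      ext b
      have := hρ0 g b
      rw [hact g hg _ b.toMul.2] at this
      exact congrArg _ (Subtype.ext this))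
  have hρ : ∀ (g : E) (b : Additive B), ((ρ (Abelianization.of g) b).toMul : E) = g * (b.toMul : E) * g⁻¹ := hρ0
  have : Group.FG (Abelianization E) := QuotientGroup.fg _
  have : Monoid.FG (Abelianization E) := Group.fg_iff_monoid_fg.mp this
  have : IsNoetherianRing (MonoidAlgebra ℤ (Abelianization E)) :=
    Algebra.FiniteType.isNoetherianRing ℤ _
  let A := MonoidAlgebra ℤ (Abelianization E)
  let M := ρ.asModule
  let sub : ∀ W : Subgroup E, W.Normal → Submodule A M := fun W hW =>
    { carrier := {x | ((ρ.asModuleEquiv x).toMul : E) ∈ W}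
      zero_mem' := by simp [W.one_mem]
      add_mem' := by
        intro x y hx hy
        simp only [Set.mem_ofPred_eq] at hx hy ⊢
        simpa using W.mul_mem hx hy
      smul_mem' := by
        intro r x hx
        simp only [Set.mem_ofPred_eq] at hx ⊢
        induction r using MonoidAlgebra.induction_on with
        | of g =>
          obtain ⟨g, rfl⟩ : ∃ g', Abelianization.of g' = g := QuotientGroup.mk_surjective g
          rw [ρ.asModuleEquiv_map_smul, Representation.asAlgebraHom_of]
          have := hρ g (ρ.asModuleEquiv x)
          change ((ρ (Abelianization.of g) _).toMul : E) ∈ W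
          rw [this]
          exact hW.conj_mem _ hx g
        | add a b ha hb =>
          rw [add_smul, map_add]
          simpa using W.mul_mem ha hb
        | smul a f hf =>
          rw [smul_assoc, map_zsmul]
          simpa using W.zpow_mem hf a }
  obtain ⟨T, hT, hTB⟩ := hfg
  have hTB' : T ⊆ B := by rw [← hTB]; exact Subgroup.subset_normalClosure
  -- key: a span containing generators contains the normal closure
  have key : ∀ (P : Submodule A M) (b : B), (b : E) ∈ Subgroup.normalClosure {x : E | ∃ y : B, (y : E) = x ∧ ρ.asModuleEquiv.symm (Additive.ofMul y) ∈ P} →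
      ρ.asModuleEquiv.symm (Additive.ofMul b) ∈ P := by
    intro P b hb
    let W : Subgroup E :=
      { carrier := {x | ∃ y : B, (y : E) = x ∧ ρ.asModuleEquiv.symm (Additive.ofMul y) ∈ P}
        one_mem' := ⟨1, rfl, by simp⟩
        mul_mem' := by
          rintro _ _ ⟨x, rfl, hx⟩ ⟨y, rfl, hy⟩
          exact ⟨x * y, rfl, by rw [ofMul_mul, map_add]; exact P.add_mem hx hy⟩
        inv_mem' := by
          rintro _ ⟨x, rfl, hx⟩
          exact ⟨x⁻¹, rfl, by rw [ofMul_inv, map_neg]; exact P.neg_mem hx⟩ }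
    have hW : W.Normal := by
      constructor
      rintro _ ⟨x, rfl, hx⟩ g
      refine ⟨MulAut.conjNormal g x, MulAut.conjNormal_apply g x, ?_⟩
      have := P.smul_mem (MonoidAlgebra.of ℤ _ (Abelianization.of g)) hx
      rw [← Representation.asModuleEquiv_symm_map_rho] at this
      exact this
    have h2 : Subgroup.normalClosure {x : E | ∃ y : B, (y : E) = x ∧ ρ.asModuleEquiv.symm (Additive.ofMul y) ∈ P} ≤ W :=
      Subgroup.normalClosure_le_normal (fun x hx => hx)
    obtain ⟨y, hy, hy'⟩ := h2 hb
    rwa [← Subtype.ext hy]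
  have hfin : Module.Finite A M := by
    refine ⟨⟨(hT.toFinset.attach.image fun t => ρ.asModuleEquiv.symm (Additive.ofMul (⟨t.1, hTB' (hT.mem_toFinset.mp t.2)⟩ : B))), ?_⟩⟩
    rw [eq_top_iff]
    intro x _
    obtain ⟨x, rfl⟩ := ρ.asModuleEquiv.symm.surjective x
    refine key _ x.toMul ?_
    have hx : (x.toMul : E) ∈ Subgroup.normalClosure T := by rw [hTB]; exact x.toMul.2
    refine Subgroup.normalClosure_mono ?_ hx
    intro t ht
    refine ⟨⟨t, hTB' ht⟩, rfl, Submodule.subset_span ?_⟩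
    simp only [Finset.coe_image, Set.mem_image]
    exact ⟨⟨t, by simpa using ht⟩, by simp, rfl⟩
  have : IsNoetherian A M := isNoetherian_of_isNoetherianRing_of_finite A M
  obtain ⟨S, hS⟩ := IsNoetherian.noetherian (sub Z hZn)
  refine ⟨(fun m => ((ρ.asModuleEquiv m).toMul : E)) '' (S : Set M), S.finite_toSet.image _, ?_⟩
  apply le_antisymm
  · apply Subgroup.normalClosure_le_normal
    rintro _ ⟨m, hm, rfl⟩
    have : m ∈ sub Z hZn := by rw [← hS]; exact Submodule.subset_span hm
    exact this
  · intro z hz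
    have h1 : ρ.asModuleEquiv.symm (Additive.ofMul (⟨z, hZ hz⟩ : B)) ∈ sub Z hZn := by
      change ((ρ.asModuleEquiv (ρ.asModuleEquiv.symm (Additive.ofMul (⟨z, hZ hz⟩ : B)))).toMul : E) ∈ Z
      simpa using hz
    rw [← hS] at h1
    have h2 : Submodule.span A (S : Set M) ≤ sub (Subgroup.normalClosure ((fun m => ((ρ.asModuleEquiv m).toMul : E)) '' (S : Set M))) Subgroup.normalClosure_normal := by
      rw [Submodule.span_le]
      intro m hm
      exact Subgroup.subset_normalClosure ⟨m, hm, rfl⟩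
    have h3 := h2 h1
    change ((ρ.asModuleEquiv (ρ.asModuleEquiv.symm (Additive.ofMul (⟨z, hZ hz⟩ : B)))).toMul : E) ∈ (Subgroup.normalClosure ((fun m => ((ρ.asModuleEquiv m).toMul : E)) '' (S : Set M))) at h3
    simpa using h3


/-- a hom onto a free group has a section -/
lemma exists_section {K A : Type*} [Group K] [Group A] [IsFreeGroup A] (f : K →* A)
    (hf : Function.Surjective f) : ∃ σ : A →* K, ∀ x, f (σ x) = x := by
  choose g hg using hf
  refine ⟨IsFreeGroup.lift (fun i => g (IsFreeGroup.of i)), fun x => ?_⟩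
  have : f.comp (IsFreeGroup.lift (fun i => g (IsFreeGroup.of i))) = MonoidHom.id A := by
    apply IsFreeGroup.ext_hom
    intro i
    simp [IsFreeGroup.lift_of, hg]
  exact DFunLike.congr_fun this x

lemma comm_central {Γ : Type*} [Group Γ] (z1 z2 s1 s2 : Γ) (h12 : Commute z1 z2) (h1 : Commute z1 s1) (h2 : Commute z1 s2)
    (h3 : Commute z2 s1) (h4 : Commute z2 s2) : ⁅z1 * s1, z2 * s2⁆ = ⁅s1, s2⁆ := by
  have e1 : z1 * s1 * (z2 * s2) = z1 * z2 * (s1 * s2) := by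
    rw [mul_assoc, ← mul_assoc s1, ← h3.eq]; group
  have e2 : z2 * s2 * (z1 * s1) = z1 * z2 * (s2 * s1) := by
    rw [mul_assoc, ← mul_assoc s2, ← h2.eq, h12.eq]; group
  have : ⁅z1 * s1, z2 * s2⁆ = (z1 * s1 * (z2 * s2)) * (z2 * s2 * (z1 * s1))⁻¹ := by
    rw [commutatorElement_def]; group
  rw [this, e1, e2, commutatorElement_def]
  have a1 : Commute (z1 * z2) s1 := h1.mul_left h3
  have a2 : Commute (z1 * z2) s2 := h2.mul_left h4
  have hz : Commute (z1 * z2) (s1 * s2 * (s2 * s1)⁻¹) :=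
    (a1.mul_right a2).mul_right (a2.mul_right a1).inv_right
  calc z1 * z2 * (s1 * s2) * (z1 * z2 * (s2 * s1))⁻¹
      = z1 * z2 * (s1 * s2 * (s2 * s1)⁻¹) * (z1 * z2)⁻¹ := by group
    _ = _ := by rw [hz.eq]; group

lemma lemC0 {E F : Type*} [Group E] [Group F] [IsFreeGroup F] (p1 : E →* F) (K2 : Subgroup E) [K2.Normal]
    (c : E) (hc : c ∈ ⁅K2, p1.ker ⊔ K2⁆) (hc1 : c ∈ p1.ker) : c ∈ ⁅p1.ker, K2⁆ := by
  set K1 := p1.ker with hK1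
  have : IsFreeGroup (K2.map p1) := subgroupIsFreeOfIsFree _
  obtain ⟨σ, hσ⟩ := exists_section (p1.subgroupMap K2) (p1.subgroupMap_surjective K2)
  let q := QuotientGroup.mk' ⁅K1, K2⁆
  have hqc : ∀ x ∈ K1, ∀ y ∈ K2, Commute (q x) (q y) := by
    intro x hx y hy
    have h : q ⁅x, y⁆ = 1 := by
      rw [← MonoidHom.mem_ker, QuotientGroup.ker_mk']
      exact Subgroup.commutator_mem_commutator hx hy
    rw [map_commutatorElement] at h
    exact commutatorElement_eq_one_iff_commute.1 h
  let h1 : K2 →* E ⧸ ⁅K1, K2⁆ := q.comp K2.subtype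
  let h2 : K2 →* E ⧸ ⁅K1, K2⁆ := h1.comp (σ.comp (p1.subgroupMap K2))
  have hz : ∀ x : K2, (x : E) * ((σ (p1.subgroupMap K2 x) : K2) : E)⁻¹ ∈ K1 := by
    intro x
    have := congrArg Subtype.val (hσ (p1.subgroupMap K2 x))
    simp only [MonoidHom.subgroupMap_apply_coe] at this
    rw [hK1, MonoidHom.mem_ker, map_mul, map_inv, this]
    simp
  have hz' : ∀ x : K2, (x : E) * ((σ (p1.subgroupMap K2 x) : K2) : E)⁻¹ ∈ K2 := fun x =>
    K2.mul_mem x.2 (K2.inv_mem (Subtype.prop _))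
  have hle : ⁅K2, K1 ⊔ K2⁆ ≤ (h1.eqLocus h2).map K2.subtype := by
    rw [Subgroup.commutator_le]
    intro a ha y hy
    obtain ⟨k1, hk1, k2, hk2, rfl⟩ := Subgroup.mem_sup_of_normal_right.1 hy
    have hmem : ⁅a, k1 * k2⁆ ∈ K2 := by
      rw [commutatorElement_def, mul_assoc, mul_assoc]
      refine K2.mul_mem ha ?_
      have := (inferInstance : K2.Normal).conj_mem a⁻¹ (K2.inv_mem ha) (k1 * k2)
      simpa [mul_assoc] using this
    refine ⟨⟨_, hmem⟩, ?_, rfl⟩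
    show h1 ⟨_, hmem⟩ = h2 ⟨_, hmem⟩
    have e1 : h1 ⟨_, hmem⟩ = ⁅q a, q k2⁆ := by
      show q ⁅a, k1 * k2⁆ = _
      rw [map_commutatorElement, map_mul, commutatorElement_def, commutatorElement_def]
      have c1 := hqc k1 hk1 _ (K2.mul_mem (K2.mul_mem ha hk2) (K2.inv_mem ha))
      simp only [map_mul, map_inv] at c1
      have c2 := hqc k1 hk1 a ha
      calc q a * (q k1 * q k2) * (q a)⁻¹ * (q k1 * q k2)⁻¹ 
          = (q a * q k1) * q k2 * (q a)⁻¹ * (q k2)⁻¹ * (q k1)⁻¹ := by group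
        _ = (q k1 * (q a * q k2 * (q a)⁻¹)) * (q k2)⁻¹ * (q k1)⁻¹ := by rw [← c2.eq]; group
        _ = (q a * q k2 * (q a)⁻¹) * (q k2 * (q k1)⁻¹ )⁻¹⁻¹⁻¹ * (q k1)⁻¹ := by
            have c3 := hqc k1 hk1 k2 hk2
            rw [c1.eq]
            have : (q k2 * (q k1)⁻¹)⁻¹⁻¹⁻¹ = q k1 * (q k2)⁻¹ := by group
            rw [this]; group
        _ = (q a * q k2 * (q a)⁻¹) * (q k1 * (q k2)⁻¹) * (q k1)⁻¹ := by group
        _ = _ := by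
          have c3 := (hqc k1 hk1 k2 hk2).inv_right
          rw [c3.eq]; group
    have e2 : p1.subgroupMap K2 ⟨_, hmem⟩ = p1.subgroupMap K2 ⁅(⟨a, ha⟩ : K2), (⟨k2, hk2⟩ : K2)⁆ := by
      ext
      have hk : p1 k1 = 1 := hk1
      simp [commutatorElement_def, hk]
    have e3 : h2 ⟨_, hmem⟩ = ⁅h2 ⟨a, ha⟩, h2 ⟨k2, hk2⟩⁆ := by
      rw [← map_commutatorElement]
      show h1 (σ _) = h1 (σ _)
      rw [e2]
    rw [e1, e3]
    have key : ∀ x : K2, q x = q ((x : E) * ((σ (p1.subgroupMap K2 x) : K2) : E)⁻¹) * h2 x := by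
      intro x
      show _ = _ * q ((σ (p1.subgroupMap K2 x) : K2) : E)
      rw [← map_mul]; simp
    have ka := key ⟨a, ha⟩
    have kb := key ⟨k2, hk2⟩
    simp only at ka kb
    have hh : ∀ x, h2 x = q ((σ (p1.subgroupMap K2 x) : K2) : E) := fun _ => rfl
    rw [ka, kb]
    have za := hz ⟨a, ha⟩
    have zb := hz ⟨k2, hk2⟩
    apply comm_central
    · exact hqc _ za _ (hz' ⟨k2, hk2⟩)
    · exact hqc _ za _ (Subtype.prop _)
    · exact hqc _ za _ (Subtype.prop _)
    · exact hqc _ zb _ (Subtype.prop _)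
    · exact hqc _ zb _ (Subtype.prop _)
  obtain ⟨⟨x, hx⟩, hxe, rfl⟩ := hle hc
  have hxe : h1 ⟨x, hx⟩ = h2 ⟨x, hx⟩ := hxe
  have : p1.subgroupMap K2 ⟨x, hx⟩ = 1 := by
    ext
    exact hc1
  have h2' : h2 ⟨x, hx⟩ = 1 := by
    show h1 (σ _) = 1
    rw [this]; simp
  rw [h2'] at hxe
  have : x ∈ q.ker := hxe
  rwa [QuotientGroup.ker_mk'] at this

theorem lemC {E F F' : Type*} [Group E] [Group F] [IsFreeGroup F] [Group F'] [Group.FG E]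
    (p1 : E →* F) (p2 : E →* F') (hK2 : p2.ker.IsFinitelyNormallyGenerated)
    (hcom : commutator E ≤ p1.ker ⊔ p2.ker) :
    ∃ T : Set E, T.Finite ∧ T ⊆ (p1.ker ⊓ p2.ker : Subgroup E) ∧
      p1.ker ⊓ p2.ker ≤ Subgroup.normalClosure T ⊔ ⁅p1.ker, p2.ker⁆ := by
  set K1 := p1.ker
  set K2 := p2.ker
  let q := QuotientGroup.mk' ⁅K2, K1 ⊔ K2⁆
  have hq : Function.Surjective q := QuotientGroup.mk'_surjective _
  have hqc : ∀ x ∈ K2, ∀ y ∈ K1 ⊔ K2, Commute (q x) (q y) := by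
    intro x hx y hy
    have h : q ⁅x, y⁆ = 1 := by
      rw [← MonoidHom.mem_ker, QuotientGroup.ker_mk']
      exact Subgroup.commutator_mem_commutator hx hy
    rw [map_commutatorElement] at h
    exact commutatorElement_eq_one_iff_commute.1 h
  have nB : (K2.map q).Normal := Subgroup.Normal.map inferInstance q hq
  have nZ : ((K1 ⊓ K2).map q).Normal := Subgroup.Normal.map inferInstance q hq
  have hfg := fng_of_le (K2.map q) ((K1 ⊓ K2).map q) nZ
    (by
      rintro _ ⟨x, hx, rfl⟩ _ ⟨y, hy, rfl⟩
      exact hqc x hx y ((le_sup_right : K2 ≤ K1 ⊔ K2) hy))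
    (by
      rintro g hg _ ⟨y, hy, rfl⟩
      have : commutator (E ⧸ ⁅K2, K1 ⊔ K2⁆) = (commutator E).map q := by
        rw [commutator_def, commutator_def, Subgroup.map_commutator, Subgroup.map_top_of_surjective q hq]
      rw [this] at hg
      obtain ⟨x, hx, rfl⟩ := hg
      have := hqc y hy x (hcom hx)
      rw [← this.eq]; group)
    (hK2.map hq) (Subgroup.map_mono inf_le_right)
  obtain ⟨S, hSf, hS⟩ := hfg
  have hSs : S ⊆ q '' ((K1 ⊓ K2 : Subgroup E) : Set E) := by
    intro s hs
    have := Subgroup.subset_normalClosure hs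
    rw [hS] at this
    exact this
  obtain ⟨T, hTs, hTf, hT⟩ : ∃ T : Set E, T ⊆ (K1 ⊓ K2 : Subgroup E) ∧ T.Finite ∧ q '' T = S := by
    obtain ⟨T, hTs, hTb⟩ := Set.SurjOn.exists_bijOn_subset (f := q)
      (s := ((K1 ⊓ K2 : Subgroup E) : Set E)) (t := S) hSs
    exact ⟨T, hTs, hTb.finite_iff_finite.2 hSf, hTb.image_eq⟩
  refine ⟨T, hTf, hTs, ?_⟩
  intro x hx
  have : q x ∈ (Subgroup.normalClosure T).map q := by
    rw [Subgroup.map_normalClosure T q hq, hT, hS]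
    exact ⟨x, hx, rfl⟩
  obtain ⟨y, hy, hyx⟩ := this
  have hyK : y ∈ K1 ⊓ K2 := Subgroup.normalClosure_le_normal hTs hy
  have hcC : y⁻¹ * x ∈ ⁅K2, K1 ⊔ K2⁆ := by
    rw [← QuotientGroup.ker_mk' ⁅K2, K1 ⊔ K2⁆, MonoidHom.mem_ker]
    show q _ = 1
    simp [hyx]
  have : y⁻¹ * x ∈ ⁅K1, K2⁆ := lemC0 p1 K2 _ hcC (K1.mul_mem (K1.inv_mem hyK.1) hx.1)
  have e : x = y * (y⁻¹ * x) := by group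
  rw [e]
  exact Subgroup.mul_mem_sup hy this

theorem fng_ker_free {E F : Type*} [Group E] [Group F] [IsFreeGroup F] [Group.FG E]
    (p : E →* F) (hp : Function.Surjective p) : p.ker.IsFinitelyNormallyGenerated := by
  obtain ⟨σ, hσ⟩ := exists_section p hp
  obtain ⟨Y, hY⟩ := Group.FG.out (G := E)
  refine ⟨(fun y => y⁻¹ * σ (p y)) '' (Y : Set E), Y.finite_toSet.image _, ?_⟩
  set R := Subgroup.normalClosure ((fun y => y⁻¹ * σ (p y)) '' (Y : Set E))
  apply le_antisymm
  · apply Subgroup.normalClosure_le_normal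
    rintro _ ⟨y, hy, rfl⟩
    rw [SetLike.mem_coe, MonoidHom.mem_ker]
    simp [hσ]
  · have h : QuotientGroup.mk' R = (QuotientGroup.mk' R).comp (σ.comp p) := by
      apply MonoidHom.eq_of_eqOn_dense hY
      intro y hy
      show (QuotientGroup.mk y : E ⧸ R) = QuotientGroup.mk (σ (p y))
      rw [QuotientGroup.eq]
      exact Subgroup.subset_normalClosure ⟨y, hy, rfl⟩
    intro x hx
    rw [← QuotientGroup.ker_mk' R, MonoidHom.mem_ker, h]
    have hx : p x = 1 := hx
    simp [hx]

theorem fng_of_commutator_le {E : Type*} [Group E] [Group.FG E] (M : Subgroup E) [M.Normal]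
    (hM : commutator E ≤ M) : M.IsFinitelyNormallyGenerated := by
  obtain ⟨Y, hY⟩ := Group.FG.out (G := E)
  have hfinA : Module.Finite ℤ (Additive (Abelianization E)) := by
    have : Group.FG (Abelianization E) := inferInstanceAs (Group.FG (E ⧸ commutator E))
    rw [Module.Finite.iff_addGroup_fg]
    exact AddGroup.fg_iff_mul_fg.2 this
  have hfg : (M.map (Abelianization.of (G := E))).FG := by
    have h1 : (AddSubgroup.toIntSubmodule (Subgroup.toAddSubgroup (M.map (Abelianization.of (G := E))))).FG :=
      IsNoetherian.noetherian _
    rw [Submodule.fg_iff_addSubgroup_fg] at h1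
    exact (Subgroup.fg_iff_add_fg _).2 h1
  obtain ⟨S, hS⟩ := hfg
  have hSs : Set.SurjOn (Abelianization.of (G := E)) (M : Set E) (S : Set (Abelianization E)) := by
    intro s hs
    have := Subgroup.subset_closure hs
    rw [hS] at this
    exact this
  obtain ⟨T, hTs, hTb⟩ := hSs.exists_bijOn_subset
  have hTf : T.Finite := hTb.finite_iff_finite.2 S.finite_toSet
  refine ⟨T ∪ Set.image2 (fun a b => ⁅a, b⁆) (Y : Set E) (Y : Set E), hTf.union (Y.finite_toSet.image2 _ Y.finite_toSet), ?_⟩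
  set R := Subgroup.normalClosure (T ∪ Set.image2 (fun a b => ⁅a, b⁆) (Y : Set E) Y) with hR
  have hcR : commutator E ≤ R := by
    have hcomm : ∀ x y : E ⧸ R, x * y = y * x := by
      have htop : Subgroup.closure (QuotientGroup.mk' R '' (Y : Set E)) = ⊤ := by
        rw [← MonoidHom.map_closure, hY, Subgroup.map_top_of_surjective _ (QuotientGroup.mk'_surjective R)]
      have hle : Subgroup.closure (QuotientGroup.mk' R '' (Y : Set E)) ≤ Subgroup.centralizer (QuotientGroup.mk' R '' (Y : Set E)) := by
        rw [Subgroup.closure_le]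
        rintro _ ⟨a, ha, rfl⟩
        rw [SetLike.mem_coe, Subgroup.mem_centralizer_iff]
        rintro _ ⟨b, hb, rfl⟩
        have : QuotientGroup.mk' R ⁅b, a⁆ = 1 := by
          rw [← MonoidHom.mem_ker, QuotientGroup.ker_mk']
          exact Subgroup.subset_normalClosure (Or.inr ⟨b, hb, a, ha, rfl⟩)
        rw [map_commutatorElement] at this
        exact (commutatorElement_eq_one_iff_commute.1 this).eq
      have hle2 := Subgroup.closure_le_centralizer_centralizer (QuotientGroup.mk' R '' (Y : Set E))
      intro x y
      have hx : x ∈ Subgroup.centralizer (QuotientGroup.mk' R '' (Y : Set E)) := hle (htop ▸ Subgroup.mem_top x)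
      have hy := hle2 (htop ▸ Subgroup.mem_top y)
      rw [Subgroup.mem_centralizer_iff] at hy
      exact hy x hx
    rw [commutator_def, Subgroup.commutator_le]
    intro a _ b _
    rw [← QuotientGroup.ker_mk' R, MonoidHom.mem_ker, map_commutatorElement, commutatorElement_eq_one_iff_commute]
    exact hcomm _ _
  apply le_antisymm
  · apply Subgroup.normalClosure_le_normal
    rintro x (hx | ⟨a, ha, b, hb, rfl⟩)
    · exact hTs hx
    · exact hM (Subgroup.commutator_mem_commutator (Subgroup.mem_top _) (Subgroup.mem_top _))
  · intro x hx
    have hx' : Abelianization.of x ∈ (Subgroup.closure T).map (Abelianization.of (G := E)) := by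
      rw [MonoidHom.map_closure, hTb.image_eq, hS]
      exact ⟨x, hx, rfl⟩
    obtain ⟨y, hy, hyx⟩ := hx'
    have h1 : y⁻¹ * x ∈ commutator E := by
      rw [← Abelianization.ker_of E, MonoidHom.mem_ker]
      simp [hyx]
    have h2 : y ∈ R := (Subgroup.closure_le_normalClosure.trans (Subgroup.normalClosure_mono Set.subset_union_left)) hy
    have := R.mul_mem h2 (hcR h1)
    simpa using this

lemma fg_fibre {A B : Type*} [Group A] [Group B] [Group.FG A] [Group.FG B] (P : Subgroup (A × B))
    (h1 : ∀ a, ∃ b, (a, b) ∈ P) (h2 : ∀ b, ∃ a, (a, b) ∈ P)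
    (M : Subgroup B) (hM : ∀ b, b ∈ M ↔ (1, b) ∈ P) (hMf : M.IsFinitelyNormallyGenerated) : P.FG := by
  obtain ⟨X, hX⟩ := Group.FG.out (G := A)
  obtain ⟨Y, hY⟩ := Group.FG.out (G := B)
  choose f hf using h1
  choose g hg using h2
  obtain ⟨S, hSf, hS⟩ := hMf
  let U : Set (A × B) := (fun a => (a, f a)) '' X ∪ (fun b => (g b, b)) '' Y ∪ (fun b => (1, b)) '' S
  have hU : U.Finite := ((X.finite_toSet.image _).union (Y.finite_toSet.image _)).union (hSf.image _)
  rw [Subgroup.fg_iff]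
  refine ⟨U, ?_, hU⟩
  set W := Subgroup.closure U with hW
  have hW1 : W.map (MonoidHom.fst A B) = ⊤ := by
    rw [eq_top_iff, ← hX, Subgroup.closure_le]
    intro a ha
    exact ⟨(a, f a), Subgroup.subset_closure (Or.inl (Or.inl ⟨a, ha, rfl⟩)), rfl⟩
  have hW2 : W.map (MonoidHom.snd A B) = ⊤ := by
    rw [eq_top_iff, ← hY, Subgroup.closure_le]
    intro a ha
    exact ⟨(g a, a), Subgroup.subset_closure (Or.inl (Or.inr ⟨a, ha, rfl⟩)), rfl⟩
  have hWM : ∀ b ∈ M, ((1, b) : A × B) ∈ W := by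
    have hn : (W.comap (MonoidHom.inr A B)).Normal := by
      constructor
      intro b hb c
      obtain ⟨⟨a, c'⟩, hac, hc⟩ : c ∈ W.map (MonoidHom.snd A B) := hW2 ▸ Subgroup.mem_top c
      obtain rfl : c' = c := hc
      have hb : ((1, b) : A × B) ∈ W := hb
      have := W.mul_mem (W.mul_mem hac hb) (W.inv_mem hac)
      simpa using this
    intro b hb
    rw [← hS] at hb
    have := Subgroup.normalClosure_le_normal (N := W.comap (MonoidHom.inr A B)) (s := S) (by
      intro s hs
      exact Subgroup.subset_closure (Or.inr ⟨s, hs, rfl⟩)) hb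
    exact this
  apply le_antisymm
  · rw [hW, Subgroup.closure_le]
    rintro x ((⟨a, _, rfl⟩ | ⟨b, _, rfl⟩) | ⟨b, hb, rfl⟩)
    · exact hf a
    · exact hg b
    · exact (hM b).1 (hS ▸ Subgroup.subset_normalClosure hb)
  · rintro ⟨u, v⟩ huv
    have hWP : W ≤ P := by
      rw [hW, Subgroup.closure_le]
      rintro x ((⟨a, _, rfl⟩ | ⟨b, _, rfl⟩) | ⟨b, hb, rfl⟩)
      · exact hf a
      · exact hg b
      · exact (hM b).1 (hS ▸ Subgroup.subset_normalClosure hb)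
    obtain ⟨⟨a, c⟩, hac, hc⟩ : u ∈ W.map (MonoidHom.fst A B) := hW1 ▸ Subgroup.mem_top u
    obtain rfl : a = u := hc
    have := P.mul_mem (P.inv_mem (hWP hac)) huv
    have h3 : c⁻¹ * v ∈ M := by rw [hM]; simpa using this
    have := W.mul_mem hac (hWM _ h3)
    simpa using this

theorem lemE {G : Type*} [Group G] (hG : FinitelyPresentedGroup G) (N : Subgroup G) [N.Normal]
    (hc : commutator G ≤ N) (μ : (G ⧸ N) ≃* (G ⧸ N)) :
    ∃ (m : ℕ) (ϕ : FreeGroup (Fin m) →* fibreProduct N N μ) (K1 K2 : Subgroup (FreeGroup (Fin m))),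
      Function.Surjective ϕ ∧ K1.Normal ∧ K2.Normal ∧ K1.IsFinitelyNormallyGenerated ∧
      K2.IsFinitelyNormallyGenerated ∧ (∀ x ∈ K2, (ϕ x).1.2 = 1) ∧ (∀ x ∈ K1, (ϕ x).1.1 = 1) ∧
      ∃ T : Set (FreeGroup (Fin m)), T.Finite ∧ T ⊆ ϕ.ker ∧
        ϕ.ker ≤ Subgroup.normalClosure T ⊔ ⁅K1, K2⁆ := by
  obtain ⟨n, π, Rel, hπ, hker⟩ := hG
  let F := FreeGroup (Fin n)
  let PF : Subgroup (F × F) := (fibreProduct N N μ).comap (π.prodMap π)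
  have hPF : ∀ a b : F, (a, b) ∈ PF ↔ μ (QuotientGroup.mk (π a)) = QuotientGroup.mk (π b) := fun _ _ => Iff.rfl
  have hcF : commutator F ≤ N.comap π := by
    rw [← Subgroup.map_le_iff_le_comap, commutator_def, Subgroup.map_commutator]
    refine le_trans (Subgroup.commutator_mono le_top le_top) hc
  have hN1 : ∀ a, a ∈ N.comap π → ((a, 1) : F × F) ∈ PF := by
    intro a ha
    rw [hPF]
    rw [(QuotientGroup.eq_one_iff (N := N) (π a)).2 ha]; simp
  have hN2 : ∀ a, a ∈ N.comap π ↔ ((1, a) : F × F) ∈ PF := by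
    intro a
    rw [hPF, Subgroup.mem_comap, ← QuotientGroup.eq_one_iff]
    simp [eq_comm]
  have s1 : ∀ a : F, ∃ b, (a, b) ∈ PF := by
    intro a
    obtain ⟨g, hg⟩ := QuotientGroup.mk_surjective (μ (QuotientGroup.mk (π a)))
    obtain ⟨b, rfl⟩ := hπ g
    exact ⟨b, by rw [hPF, hg]⟩
  have s2 : ∀ b : F, ∃ a, (a, b) ∈ PF := by
    intro b
    obtain ⟨g, hg⟩ := QuotientGroup.mk_surjective (μ.symm (QuotientGroup.mk (π b)))
    obtain ⟨a, rfl⟩ := hπ g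
    exact ⟨a, by rw [hPF, hg]; simp⟩
  have hfg : PF.FG := fg_fibre PF s1 s2 (N.comap π) hN2 (fng_of_commutator_le _ hcF)
  have hfg' : Group.FG PF := (Group.fg_iff_subgroup_fg PF).2 hfg
  obtain ⟨m, ψ, hψ⟩ : ∃ (m : ℕ) (ψ : FreeGroup (Fin m) →* PF), Function.Surjective ψ := by
    obtain ⟨S, hS⟩ := hfg'.out
    let e := S.equivFin
    refine ⟨S.card, FreeGroup.lift (fun i => ((e.symm i : S) : PF)), ?_⟩
    rw [← MonoidHom.range_eq_top, FreeGroup.range_lift_eq_closure, ← hS]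
    congr 1
    ext x
    constructor
    · rintro ⟨i, rfl⟩; simp
    · intro hx; exact ⟨e ⟨x, hx⟩, by simp⟩
  let p1 : FreeGroup (Fin m) →* F := (MonoidHom.fst F F).comp (PF.subtype.comp ψ)
  let p2 : FreeGroup (Fin m) →* F := (MonoidHom.snd F F).comp (PF.subtype.comp ψ)
  have hlift : ∀ a b : F, (a, b) ∈ PF → ∃ x, p1 x = a ∧ p2 x = b := by
    intro a b hab
    obtain ⟨x, hx⟩ := hψ ⟨(a, b), hab⟩
    exact ⟨x, by simp [p1, hx], by simp [p2, hx]⟩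
  have hp1 : Function.Surjective p1 := fun a => by
    obtain ⟨b, hb⟩ := s1 a
    obtain ⟨x, hx, _⟩ := hlift a b hb
    exact ⟨x, hx⟩
  have hp2 : Function.Surjective p2 := fun b => by
    obtain ⟨a, ha⟩ := s2 b
    obtain ⟨x, _, hx⟩ := hlift a b ha
    exact ⟨x, hx⟩
  have hmem : ∀ x, (p1 x, p2 x) ∈ PF := fun x => (ψ x).2
  let ϕ : FreeGroup (Fin m) →* fibreProduct N N μ :=
    ((π.prodMap π).comp (PF.subtype.comp ψ)).codRestrict _ (fun x => (ψ x).2)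
  have hϕ : ∀ x, ((ϕ x : G × G)) = (π (p1 x), π (p2 x)) := fun x => rfl
  have hcom : commutator (FreeGroup (Fin m)) ≤ p1.ker ⊔ p2.ker := by
    intro x hx
    have h1 : p1 x ∈ N.comap π := by
      apply hcF
      have : p1 x ∈ (commutator _).map p1 := ⟨x, hx, rfl⟩
      rw [commutator_def, Subgroup.map_commutator] at this
      exact (Subgroup.commutator_mono le_top le_top) this
    obtain ⟨y, hy1, hy2⟩ := hlift _ _ (hN1 _ h1)
    have e : x = (x * y⁻¹) * y := by group
    rw [e]
    refine Subgroup.mul_mem_sup ?_ hy2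
    rw [MonoidHom.mem_ker, map_mul, map_inv, hy1]; simp
  have f1 := fng_ker_free p1 hp1
  have f2 := fng_ker_free p2 hp2
  obtain ⟨T, hTf, hTs, hT⟩ := lemC p1 p2 f2 hcom
  have hRel : ∀ r ∈ Rel, r ∈ N.comap π := by
    intro r hr
    have : r ∈ π.ker := by rw [hker]; exact Subgroup.subset_normalClosure hr
    rw [Subgroup.mem_comap, MonoidHom.mem_ker.1 this]; exact N.one_mem
  have hw1 : ∀ r : Rel, ∃ x, p1 x = r ∧ p2 x = 1 := fun r => hlift _ _ (hN1 _ (hRel r r.2))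
  have hw2 : ∀ r : Rel, ∃ x, p1 x = 1 ∧ p2 x = r := fun r => hlift _ _ ((hN2 _).1 (hRel r r.2))
  choose w1 hw1a hw1b using hw1
  choose w2 hw2a hw2b using hw2
  have hkerϕ : ∀ x, x ∈ ϕ.ker ↔ p1 x ∈ π.ker ∧ p2 x ∈ π.ker := by
    intro x
    rw [MonoidHom.mem_ker, Subtype.ext_iff, hϕ, MonoidHom.mem_ker, MonoidHom.mem_ker]
    simp [Prod.ext_iff]
  have r1 : ∀ r : Rel, (r : F) ∈ π.ker := fun r => by
    rw [hker]; exact Subgroup.subset_normalClosure r.2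
  refine ⟨m, ϕ, p1.ker, p2.ker, ?_, inferInstance, inferInstance, f1, f2, ?_, ?_,
    T ∪ Set.range w1 ∪ Set.range w2, (hTf.union (Set.finite_range _)).union (Set.finite_range _), ?_, ?_⟩
  · rintro ⟨⟨a, b⟩, hab⟩
    obtain ⟨a, rfl⟩ := hπ a
    obtain ⟨b, rfl⟩ := hπ b
    obtain ⟨x, hx1, hx2⟩ := hlift a b hab
    exact ⟨x, Subtype.ext (by rw [hϕ, hx1, hx2])⟩
  · intro x hx
    rw [hϕ, MonoidHom.mem_ker.1 hx]; simp
  · intro x hx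
    rw [hϕ, MonoidHom.mem_ker.1 hx]; simp
  · rintro x ((hx | ⟨r, rfl⟩) | ⟨r, rfl⟩) <;> rw [SetLike.mem_coe, hkerϕ]
    · have := hTs hx
      rw [MonoidHom.mem_ker.1 this.1, MonoidHom.mem_ker.1 this.2]
      exact ⟨one_mem _, one_mem _⟩
    · rw [hw1a, hw1b]; exact ⟨r1 r, one_mem _⟩
    · rw [hw2a, hw2b]; exact ⟨one_mem _, r1 r⟩
  · intro x hx
    rw [hkerϕ, hker] at hx
    set D := Subgroup.normalClosure (T ∪ Set.range w1 ∪ Set.range w2)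
    have d1 : Subgroup.normalClosure (Set.range w1) ≤ D :=
      Subgroup.normalClosure_mono (Set.subset_union_of_subset_left Set.subset_union_right _)
    have d2 : Subgroup.normalClosure (Set.range w2) ≤ D :=
      Subgroup.normalClosure_mono Set.subset_union_right
    have d3 : Subgroup.normalClosure T ≤ D :=
      Subgroup.normalClosure_mono (Set.subset_union_of_subset_left Set.subset_union_left _)
    have k1 : Subgroup.normalClosure (Set.range w1) ≤ p2.ker :=
      Subgroup.normalClosure_le_normal (by rintro _ ⟨r, rfl⟩; exact hw1b r)
    have k2 : Subgroup.normalClosure (Set.range w2) ≤ p1.ker :=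
      Subgroup.normalClosure_le_normal (by rintro _ ⟨r, rfl⟩; exact hw2a r)
    have m1 : (Subgroup.normalClosure (Set.range w1)).map p1 = Subgroup.normalClosure (Rel : Set F) := by
      rw [Subgroup.map_normalClosure _ p1 hp1, ← Set.range_comp]
      congr 1
      ext r
      constructor
      · rintro ⟨r, rfl⟩; simp [hw1a]
      · intro hr; exact ⟨⟨r, hr⟩, hw1a _⟩
    have m2 : (Subgroup.normalClosure (Set.range w2)).map p2 = Subgroup.normalClosure (Rel : Set F) := by
      rw [Subgroup.map_normalClosure _ p2 hp2, ← Set.range_comp]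
      congr 1
      ext r
      constructor
      · rintro ⟨r, rfl⟩; simp [hw2b]
      · intro hr; exact ⟨⟨r, hr⟩, hw2b _⟩
    obtain ⟨hx1, hx2⟩ := hx
    rw [← m1] at hx1
    rw [← m2] at hx2
    obtain ⟨y, hy, hyx⟩ := hx1
    obtain ⟨z, hz, hzx⟩ := hx2
    have hzz : z⁻¹ * (y⁻¹ * x) ∈ p1.ker ⊓ p2.ker := by
      constructor
      · show p1 _ = 1
        have : p1 z = 1 := k2 hz
        simp [this, hyx]
      · show p2 _ = 1
        have : p2 y = 1 := k1 hy
        simp [this, hzx]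
    have e : x = y * (z * (z⁻¹ * (y⁻¹ * x))) := by group
    rw [e]
    refine mul_mem ((le_sup_left : D ≤ _) (d1 hy)) (mul_mem ((le_sup_left : D ≤ _) (d2 hz)) ?_)
    exact (sup_le_sup d3 le_rfl) (hT hzz)


section
variable {Γ β : Type*} [Group Γ]

lemma mem_normalizer_of (H : Subgroup Γ) (x : Γ) (h1 : ∀ h ∈ H, x * h * x⁻¹ ∈ H)
    (h2 : ∀ h ∈ H, x⁻¹ * h * x ∈ H) : x ∈ Subgroup.normalizer (H : Set Γ) := by
  rw [Subgroup.mem_normalizer_iff]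
  intro h
  refine ⟨h1 h, fun hh => ?_⟩
  have := h2 _ hh
  have e : x⁻¹ * (x * h * x⁻¹) * x = h := by group
  rwa [e] at this

lemma conj_closure {S : Set Γ} {H : Subgroup Γ} {x : Γ} (h : ∀ s ∈ S, x * s * x⁻¹ ∈ H) :
    ∀ s ∈ Subgroup.closure S, x * s * x⁻¹ ∈ H := by
  have : Subgroup.closure S ≤ H.comap (MulAut.conj x).toMonoidHom := by
    rw [Subgroup.closure_le]
    intro s hs
    exact h s hs
  intro s hs
  exact this hs

lemma com_closure {S S' : Set Γ} {x : Γ} (h : ∀ s ∈ S, ∀ s' ∈ S', Commute s (x * s' * x⁻¹)) :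
    Com (Subgroup.closure S) (Subgroup.closure S') x := by
  intro l hl r hr
  have : x * r * x⁻¹ ∈ Subgroup.closure ((MulAut.conj x).toMonoidHom '' S') := by
    rw [← MonoidHom.map_closure]
    exact ⟨r, hr, rfl⟩
  refine commute_closure ?_ hl this
  rintro s hs _ ⟨s', hs', rfl⟩
  exact h s hs s' hs'

/-- normality of `cl` -/
lemma cl_normal (val : β → Γ) (inv : β → β) (hinv : ∀ b, val (inv b) = (val b)⁻¹) (L V : Subgroup Γ)
    (hcom : ∀ l ∈ cl val L Set.univ, ∀ r ∈ V, Commute l r)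
    (Y : Set Γ) (hY : Subgroup.closure Y = ⊤) (hYi : ∀ y ∈ Y, y⁻¹ ∈ Y)
    (hL : ∀ y ∈ Y, ∀ l ∈ L, y * l * y⁻¹ ∈ cl val L Set.univ)
    (hb : ∀ y ∈ Y, ∀ b, ∃ l ∈ cl val L Set.univ, ∃ r ∈ V, y * val b * y⁻¹ = val b * l * r) :
    (cl val L Set.univ).Normal := by
  set U := cl val L Set.univ with hU
  have hv1 : ∀ b, ∀ h ∈ U, val b * h * (val b)⁻¹ ∈ U := by
    intro b
    apply conj_closure
    rintro _ ⟨w, _, t, ht, rfl⟩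
    have := mem_cl val L (W := Set.univ) (w := b :: w) (Set.mem_univ _) ht
    simpa [mul_assoc] using this
  have hv : ∀ b, val b ∈ Subgroup.normalizer (U : Set Γ) := by
    intro b
    refine mem_normalizer_of U _ (hv1 b) ?_
    intro h hh
    have := hv1 (inv b) h hh
    simpa [hinv] using this
  have hVn : V ≤ Subgroup.normalizer (U : Set Γ) := by
    intro r hr
    refine mem_normalizer_of U _ ?_ ?_
    · intro h hh
      rw [← (hcom h hh r hr).eq]; simpa using hh
    · intro h hh
      rw [mul_assoc, (hcom h hh r hr).eq]; simpa using hh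
  have hyw : ∀ y ∈ Y, ∀ w : List β, y * wv val w * y⁻¹ ∈ Subgroup.normalizer (U : Set Γ) := by
    intro y hy w
    induction w with
    | nil => simpa using one_mem _
    | cons b w ih =>
      obtain ⟨l, hl, r, hr, e⟩ := hb y hy b
      have e2 : y * wv val (b :: w) * y⁻¹ = (y * val b * y⁻¹) * (y * wv val w * y⁻¹) := by
        rw [wv_cons]; group
      rw [e2, e]
      exact mul_mem (mul_mem (mul_mem (hv b) (Subgroup.le_normalizer hl)) (hVn hr)) ih
  have hyU : ∀ y ∈ Y, ∀ h ∈ U, y * h * y⁻¹ ∈ U := by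
    intro y hy
    apply conj_closure
    rintro _ ⟨w, _, t, ht, rfl⟩
    have h1 := hyw y hy w
    rw [Subgroup.mem_normalizer_iff] at h1
    have h2 := (h1 _).1 (hL y hy t ht)
    convert h2 using 1
    group
  rw [← Subgroup.normalizer_eq_top_iff, eq_top_iff, ← hY, Subgroup.closure_le]
  intro y hy
  refine mem_normalizer_of U _ (hyU y hy) ?_
  intro h hh
  simpa using hyU _ (hYi y hy) h hh
end

lemma hmap {E Δ ι : Type*} [Group E] [Group Δ] (f : E →* Δ) (u : ι → E) :
    (Subgroup.closure (Set.range u)).map f = Subgroup.closure (Set.range fun i => f (u i)) := by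
  rw [MonoidHom.map_closure, ← Set.range_comp]; rfl

lemma wv_map {E Δ β : Type*} [Group E] [Group Δ] (f : E →* Δ) (val : β → E) (w : List β) :
    wv (fun b => f (val b)) w = f (wv val w) := by
  simp [wv, map_list_prod, Function.comp_def]

set_option maxHeartbeats 4000000 in
theorem lemF {E P β ι : Type*} [Group E] [Group.FG E] [Group P] [Fintype β] [DecidableEq β]
    [Finite ι] (ϕ : E →* P)
    (K1 K2 : Subgroup E) (hn1 : K1.Normal) (hn2 : K2.Normal)
    (hK1 : K1.IsFinitelyNormallyGenerated) (hK2 : K2.IsFinitelyNormallyGenerated)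
    (T : Set E) (hTf : T.Finite) (hTs : T ⊆ ϕ.ker) (hT : ϕ.ker ≤ Subgroup.normalClosure T ⊔ ⁅K1, K2⁆)
    (val : β → E) (ul : ι → E) (ur : ι → E) (κ : β → E) (inv : β → β) (v : β → P) (hv : v = fun b => ϕ (val b))
    (hinv : ∀ b, v (inv b) = (v b)⁻¹)
    (L R : Subgroup P) (hLdef : L = Subgroup.closure (Set.range fun i => ϕ (ul i)))
    (hRdef : R = Subgroup.closure (Set.range fun i => ϕ (ur i)))
    (c e : ℕ) (he : 2 * c + 1 ≤ e)
    (hsw : ∀ b b', ∃ l ∈ L, ∃ r ∈ R, v b * v b' = l * r * (v b' * v b))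
    (h1 : ∀ b, ∀ l ∈ L, (ϕ (κ b) * (v b ^ e)⁻¹) * l * (ϕ (κ b) * (v b ^ e)⁻¹)⁻¹ ∈ cl v L {w | w.length ≤ c})
    (h2 : ∀ b, ∀ r ∈ R, ϕ (κ b) * r * (ϕ (κ b))⁻¹ ∈ cl v R {w | w.length ≤ c})
    (h3 : ∀ b b', ∃ l ∈ cl v L {w | w.length ≤ c + e}, ∃ r ∈ cl v R {w | w.length ≤ c},
      ϕ (κ b) * v b' * (ϕ (κ b))⁻¹ = v b' * l * r)
    (h3' : ∀ b, ∃ l ∈ cl v L {w | w.length ≤ c}, ∃ r ∈ cl v R {w | w.length ≤ c},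
      ϕ (κ b) * v b * (ϕ (κ b))⁻¹ = v b * l * r)
    (h0 : ∀ l ∈ cl v L Set.univ, ∀ r ∈ cl v R Set.univ, Commute l r)
    (hUL : (cl v L Set.univ).Normal) (hUR : (cl v R Set.univ).Normal)
    (hg : ∀ g b, ∃ l ∈ cl v L Set.univ, ∃ r ∈ cl v R Set.univ, g * v b * g⁻¹ = v b * l * r)
    (hk2 : K2.map ϕ ≤ cl v L Set.univ) (hk1 : K1.map ϕ ≤ cl v R Set.univ) :
    ϕ.ker.IsFinitelyNormallyGenerated := by
  classical
  let q := fun S : Finset ϕ.ker => QuotientGroup.mk' (Subgroup.normalClosure (Subtype.val '' (S : Set ϕ.ker)))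
  have hq : ∀ S, Function.Surjective (q S) := fun S => QuotientGroup.mk'_surjective _
  have hev : ∀ x y, ϕ x = ϕ y → ∀ᶠ S in Filter.atTop, q S x = q S y := by
    intro x y hxy
    have hk : x⁻¹ * y ∈ ϕ.ker := by rw [MonoidHom.mem_ker]; simp [hxy]
    filter_upwards [Filter.eventually_ge_atTop {⟨x⁻¹ * y, hk⟩}] with S hS
    show (QuotientGroup.mk x : E ⧸ _) = QuotientGroup.mk y
    rw [QuotientGroup.eq]
    apply Subgroup.subset_normalClosure
    exact ⟨⟨_, hk⟩, by simpa using hS, rfl⟩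
  have lift : ∀ (u : ι → E) (M : Subgroup P) (hM : M = Subgroup.closure (Set.range fun i => ϕ (u i)))
      (W : Set (List β)) (x : P), x ∈ cl v M W → ∃ y ∈ cl val (Subgroup.closure (Set.range u)) W, ϕ y = x := by
    intro u M hM W x hx
    rw [hM, hv, ← hmap ϕ u] at hx
    have := cl_map val ϕ (Subgroup.closure (Set.range u)) W
    have hx2 : x ∈ (cl val (Subgroup.closure (Set.range u)) W).map ϕ := by rw [this]; exact hx
    exact hx2
  have qcl : ∀ (u : ι → E) (S) (W : Set (List β)) (y : E), y ∈ cl val (Subgroup.closure (Set.range u)) W →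
      q S y ∈ cl (fun b => q S (val b)) (Subgroup.closure (Set.range fun i => q S (u i))) W := by
    intro u S W y hy
    have := cl_map val (q S) (Subgroup.closure (Set.range u)) W
    rw [hmap] at this
    have h : q S y ∈ (cl val (Subgroup.closure (Set.range u)) W).map (q S) := ⟨y, hy, rfl⟩
    rw [this] at h
    exact h
  have evmem : ∀ (u : ι → E) (M : Subgroup P) (hM : M = Subgroup.closure (Set.range fun i => ϕ (u i)))
      (W : Set (List β)) (x : E), ϕ x ∈ cl v M W → ∀ᶠ S in Filter.atTop,
       q S x ∈ cl (fun b => q S (val b)) (Subgroup.closure (Set.range fun i => q S (u i))) W := by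
    intro u M hM W x hx
    obtain ⟨y, hy, hyx⟩ := lift u M hM W _ hx
    filter_upwards [hev y x hyx] with S hS
    rw [← hS]
    exact qcl u S W y hy
  have evlr : ∀ (W W' : Set (List β)) (x : E) (z : E), (∃ l ∈ cl v L W, ∃ r ∈ cl v R W', ϕ x = ϕ z * l * r) →
      ∀ᶠ S in Filter.atTop, ∃ l ∈ cl (fun b => q S (val b)) (Subgroup.closure (Set.range fun i => q S (ul i))) W,
        ∃ r ∈ cl (fun b => q S (val b)) (Subgroup.closure (Set.range fun i => q S (ur i))) W', q S x = q S z * l * r := by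
    rintro W W' x z ⟨l, hl, r, hr, hx⟩
    obtain ⟨l', hl', rfl⟩ := lift ul L hLdef W l hl
    obtain ⟨r', hr', rfl⟩ := lift ur R hRdef W' r hr
    rw [← map_mul, ← map_mul] at hx
    filter_upwards [hev _ _ hx] with S hS
    exact ⟨q S l', qcl ul S W _ hl', q S r', qcl ur S W' _ hr', by rw [hS, map_mul, map_mul]⟩
  have hvb : ∀ b, v b = ϕ (val b) := fun b => by rw [hv]
  have hLm : ∀ i, ϕ (ul i) ∈ L := fun i => by rw [hLdef]; exact Subgroup.subset_closure ⟨i, rfl⟩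
  have hRm : ∀ i, ϕ (ur i) ∈ R := fun i => by rw [hRdef]; exact Subgroup.subset_closure ⟨i, rfl⟩
  obtain ⟨Y0, hY0⟩ := Group.FG.out (G := E)
  let Y : Set E := (Y0 : Set E) ∪ (Y0 : Set E)⁻¹
  have hYf : Y.Finite := Y0.finite_toSet.union Y0.finite_toSet.inv
  have hYtop : Subgroup.closure Y = ⊤ := by
    rw [eq_top_iff, ← hY0]; exact Subgroup.closure_mono Set.subset_union_left
  have hYi : ∀ y ∈ Y, y⁻¹ ∈ Y := by
    rintro y (hy | hy)
    · right; simpa using hy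
    · left; simpa using hy
  have : Finite Y := hYf
  obtain ⟨S1, hS1f, hS1⟩ := hK1
  obtain ⟨S2, hS2f, hS2⟩ := hK2
  have : Finite S1 := hS1f
  have : Finite S2 := hS2f
  have : Finite T := hTf
  have hWf : Finite {w : List β // w.length ≤ Fintype.card β * (e + 2 * c)} := (List.finite_length_le β _)
  -- eventual statements
  have ev_inv : ∀ᶠ S in Filter.atTop, ∀ b, q S (val (inv b)) = (q S (val b))⁻¹ := by
    rw [Filter.eventually_all]
    intro b
    have := hev (val (inv b)) ((val b)⁻¹) (by rw [map_inv, ← hvb, ← hvb, hinv])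
    simpa only [map_inv] using this
  have ev_sw : ∀ᶠ S in Filter.atTop, ∀ b b', ∃ l ∈ Subgroup.closure (Set.range fun i => q S (ul i)),
      ∃ r ∈ Subgroup.closure (Set.range fun i => q S (ur i)),
      q S (val b) * q S (val b') = l * r * (q S (val b') * q S (val b)) := by
    simp only [Filter.eventually_all]
    intro b b'
    obtain ⟨l, hl, r, hr, hx⟩ := hsw b b'
    rw [hLdef, ← hmap] at hl
    rw [hRdef, ← hmap] at hr
    obtain ⟨l', hl', rfl⟩ := hl
    obtain ⟨r', hr', rfl⟩ := hr
    simp only [hvb, ← map_mul] at hx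
    filter_upwards [hev _ _ hx] with S hS
    refine ⟨q S l', ?_, q S r', ?_, ?_⟩
    · rw [← hmap]; exact ⟨l', hl', rfl⟩
    · rw [← hmap]; exact ⟨r', hr', rfl⟩
    · simp only [← map_mul]; exact hS
  have ev_1 : ∀ᶠ S in Filter.atTop, ∀ b i, (q S (κ b) * (q S (val b) ^ e)⁻¹) * q S (ul i) * (q S (κ b) * (q S (val b) ^ e)⁻¹)⁻¹ ∈
      cl (fun b => q S (val b)) (Subgroup.closure (Set.range fun i => q S (ul i))) {w | w.length ≤ c} := by
    simp only [Filter.eventually_all]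
    intro b i
    have := evmem ul L hLdef {w | w.length ≤ c} ((κ b * (val b ^ e)⁻¹) * ul i * (κ b * (val b ^ e)⁻¹)⁻¹)
      (by simpa only [map_mul, map_inv, map_pow, hvb] using h1 b _ (hLm i))
    simpa only [map_mul, map_inv, map_pow] using this
  have ev_2 : ∀ᶠ S in Filter.atTop, ∀ b i, q S (κ b) * q S (ur i) * (q S (κ b))⁻¹ ∈
      cl (fun b => q S (val b)) (Subgroup.closure (Set.range fun i => q S (ur i))) {w | w.length ≤ c} := by
    simp only [Filter.eventually_all]
    intro b i
    have := evmem ur R hRdef {w | w.length ≤ c} (κ b * ur i * (κ b)⁻¹)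
      (by simpa only [map_mul, map_inv, map_pow, hvb] using h2 b _ (hRm i))
    simpa only [map_mul, map_inv, map_pow] using this
  have ev_3 : ∀ᶠ S in Filter.atTop, ∀ b b',
     ∃ l ∈ cl (fun b => q S (val b)) (Subgroup.closure (Set.range fun i => q S (ul i))) {w | w.length ≤ c + e},
        ∃ r ∈ cl (fun b => q S (val b)) (Subgroup.closure (Set.range fun i => q S (ur i))) {w | w.length ≤ c},
        q S (κ b) * q S (val b') * (q S (κ b))⁻¹ = q S (val b') * l * r := by
    simp only [Filter.eventually_all]
    intro b b'
    have := evlr {w | w.length ≤ c + e} {w | w.length ≤ c} (κ b * val b' * (κ b)⁻¹) (val b')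
      (by simpa only [map_mul, map_inv, hvb] using h3 b b')
    simpa only [map_mul, map_inv] using this
  have ev_3' : ∀ᶠ S in Filter.atTop, ∀ b,
     ∃ l ∈ cl (fun b => q S (val b)) (Subgroup.closure (Set.range fun i => q S (ul i))) {w | w.length ≤ c},
        ∃ r ∈ cl (fun b => q S (val b)) (Subgroup.closure (Set.range fun i => q S (ur i))) {w | w.length ≤ c},
        q S (κ b) * q S (val b) * (q S (κ b))⁻¹ = q S (val b) * l * r := by
    simp only [Filter.eventually_all]
    intro b
    have := evlr {w | w.length ≤ c} {w | w.length ≤ c} (κ b * val b * (κ b)⁻¹) (val b)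
      (by simpa only [map_mul, map_inv, hvb] using h3' b)
    simpa only [map_mul, map_inv] using this
  have ev_0 : ∀ᶠ S in Filter.atTop, ∀ (w : {w : List β // w.length ≤ Fintype.card β * (e + 2 * c)}) i j,
      Commute (q S (ul i)) (wv (fun b => q S (val b)) w.1 * q S (ur j) * (wv (fun b => q S (val b)) w.1)⁻¹) := by
    simp only [Filter.eventually_all]
    intro w i j
    have hc := h0 (ϕ (ul i)) (le_cl v L (Set.mem_univ _) (hLm i)) _ (mem_cl v R (Set.mem_univ w.1) (hRm j))
    rw [hv, wv_map] at hc
    simp only [commute_iff_eq, ← map_mul, ← map_inv] at hc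
    filter_upwards [hev _ _ hc] with S hS
    rw [wv_map]
    simp only [commute_iff_eq, ← map_mul, ← map_inv]
    exact hS
  have ev_yl : ∀ᶠ S in Filter.atTop, ∀ (y : Y) i, q S y * q S (ul i) * (q S y)⁻¹ ∈
      cl (fun b => q S (val b)) (Subgroup.closure (Set.range fun i => q S (ul i))) Set.univ := by
    simp only [Filter.eventually_all]
    intro y i
    have := evmem ul L hLdef Set.univ (y * ul i * (y : E)⁻¹)
      (by simpa only [map_mul, map_inv] using hUL.conj_mem _ (le_cl v L (Set.mem_univ _) (hLm i)) (ϕ y))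
    simpa only [map_mul, map_inv] using this
  have ev_yr : ∀ᶠ S in Filter.atTop, ∀ (y : Y) i, q S y * q S (ur i) * (q S y)⁻¹ ∈
      cl (fun b => q S (val b)) (Subgroup.closure (Set.range fun i => q S (ur i))) Set.univ := by
    simp only [Filter.eventually_all]
    intro y i
    have := evmem ur R hRdef Set.univ (y * ur i * (y : E)⁻¹)
      (by simpa only [map_mul, map_inv] using hUR.conj_mem _ (le_cl v R (Set.mem_univ _) (hRm i)) (ϕ y))
    simpa only [map_mul, map_inv] using this
  have ev_yb : ∀ᶠ S in Filter.atTop, ∀ (y : Y) b,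
     ∃ l ∈ cl (fun b => q S (val b)) (Subgroup.closure (Set.range fun i => q S (ul i))) Set.univ,
        ∃ r ∈ cl (fun b => q S (val b)) (Subgroup.closure (Set.range fun i => q S (ur i))) Set.univ,
        q S y * q S (val b) * (q S y)⁻¹ = q S (val b) * l * r := by
    simp only [Filter.eventually_all]
    intro y b
    have := evlr Set.univ Set.univ (y * val b * (y : E)⁻¹) (val b)
      (by simpa only [map_mul, map_inv, hvb] using hg (ϕ y) b)
    simpa only [map_mul, map_inv] using this
  have ev_k2 : ∀ᶠ S in Filter.atTop, ∀ (k : S2), q S k ∈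
      cl (fun b => q S (val b)) (Subgroup.closure (Set.range fun i => q S (ul i))) Set.univ := by
    simp only [Filter.eventually_all]
    intro k
    exact evmem ul L hLdef _ _ (hk2 ⟨k, hS2 ▸ Subgroup.subset_normalClosure k.2, rfl⟩)
  have ev_k1 : ∀ᶠ S in Filter.atTop, ∀ (k : S1), q S k ∈
      cl (fun b => q S (val b)) (Subgroup.closure (Set.range fun i => q S (ur i))) Set.univ := by
    simp only [Filter.eventually_all]
    intro k
    exact evmem ur R hRdef _ _ (hk1 ⟨k, hS1 ▸ Subgroup.subset_normalClosure k.2, rfl⟩)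
  have ev_T : ∀ᶠ S in Filter.atTop, ∀ (t : T), q S t = 1 := by
    simp only [Filter.eventually_all]
    intro t
    have := hev t 1 (by rw [map_one]; exact hTs t.2)
    simpa only [map_one] using this
  obtain ⟨S, s_inv, s_sw, s_1, s_2, s_3, s_3', s_0, s_yl, s_yr, s_yb, s_k2, s_k1, s_T⟩ :=
    (ev_inv.and (ev_sw.and (ev_1.and (ev_2.and (ev_3.and (ev_3'.and (ev_0.and (ev_yl.and (ev_yr.and (ev_yb.and
      (ev_k2.and (ev_k1.and ev_T)))))))))))).exists
  refine ⟨Subtype.val '' (S : Set ϕ.ker), S.finite_toSet.image _, ?_⟩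
  set nS := Subgroup.normalClosure (Subtype.val '' (S : Set ϕ.ker)) with hnS
  set LS := Subgroup.closure (Set.range fun i => q S (ul i)) with hLS
  set RS := Subgroup.closure (Set.range fun i => q S (ur i)) with hRS
  set vS := fun b => q S (val b) with hvS
  have key := lemA vS inv s_inv LS RS c e he s_sw (fun b => q S (κ b))
    (fun b => conj_closure (by rintro _ ⟨i, rfl⟩; exact s_1 b i))
    (fun b => conj_closure (by rintro _ ⟨i, rfl⟩; exact s_2 b i)) s_3 s_3'
    (fun w hw => com_closure (by rintro _ ⟨i, rfl⟩ _ ⟨j, rfl⟩; exact s_0 ⟨w, hw⟩ i j))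
  have hcomm : ∀ l ∈ cl vS LS Set.univ, ∀ r ∈ cl vS RS Set.univ, Commute l r := by
    intro l hl r hr
    refine commute_closure ?_ hl hr
    rintro _ ⟨w, _, t, ht, rfl⟩ _ ⟨w', _, t', ht', rfl⟩
    rw [← commute_conj_iff (wv vS w)⁻¹]
    have := key ((w.map inv).reverse ++ w') t ht t' ht'
    rw [wv_append, wv_inv vS inv s_inv] at this
    convert this using 1 <;> group
  have hYS : Subgroup.closure (q S '' Y) = ⊤ := by
    rw [← MonoidHom.map_closure, hYtop, Subgroup.map_top_of_surjective _ (hq S)]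
  have hYSi : ∀ y ∈ q S '' Y, y⁻¹ ∈ q S '' Y := by
    rintro _ ⟨y, hy, rfl⟩
    exact ⟨y⁻¹, hYi y hy, by simp⟩
  have nL : (cl vS LS Set.univ).Normal := by
    refine cl_normal vS inv s_inv LS (cl vS RS Set.univ) hcomm (q S '' Y) hYS hYSi ?_ ?_
    · rintro _ ⟨y, hy, rfl⟩
      exact conj_closure (by rintro _ ⟨i, rfl⟩; exact s_yl ⟨y, hy⟩ i)
    · rintro _ ⟨y, hy, rfl⟩ b
      exact s_yb ⟨y, hy⟩ b
  have nR : (cl vS RS Set.univ).Normal := by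
    refine cl_normal vS inv s_inv RS (cl vS LS Set.univ) (fun l hl r hr => (hcomm r hr l hl).symm) (q S '' Y) hYS hYSi ?_ ?_
    · rintro _ ⟨y, hy, rfl⟩
      exact conj_closure (by rintro _ ⟨i, rfl⟩; exact s_yr ⟨y, hy⟩ i)
    · rintro _ ⟨y, hy, rfl⟩ b
      obtain ⟨l, hl, r, hr, hh⟩ := s_yb ⟨y, hy⟩ b
      exact ⟨r, hr, l, hl, by rw [hh, mul_assoc, (hcomm l hl r hr).eq, mul_assoc]⟩
  have c2 : K2 ≤ (cl vS LS Set.univ).comap (q S) := by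
    rw [← hS2]
    exact Subgroup.normalClosure_le_normal (fun k hk => s_k2 ⟨k, hk⟩)
  have c1 : K1 ≤ (cl vS RS Set.univ).comap (q S) := by
    rw [← hS1]
    exact Subgroup.normalClosure_le_normal (fun k hk => s_k1 ⟨k, hk⟩)
  have hkq : (q S).ker = nS := QuotientGroup.ker_mk' _
  apply le_antisymm
  · apply Subgroup.normalClosure_le_normal
    rintro _ ⟨x, _, rfl⟩
    exact x.2
  · refine hT.trans (sup_le ?_ ?_)
    · apply Subgroup.normalClosure_le_normal
      intro t ht
      rw [← hkq]
      exact s_T ⟨t, ht⟩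
    · rw [Subgroup.commutator_le]
      intro a ha b hb
      rw [← hkq, MonoidHom.mem_ker, map_commutatorElement, commutatorElement_eq_one_iff_commute]
      exact (hcomm _ (c2 hb) _ (c1 ha)).symm

section
variable {Γ β : Type*} [Group Γ]

lemma mem_cl_le (v : β → Γ) (T : Subgroup Γ) {x : Γ} (hx : x ∈ cl v T Set.univ) :
    ∀ᶠ c : ℕ in Filter.atTop, x ∈ cl v T {w | w.length ≤ c} := by
  unfold cl at hx
  induction hx using Subgroup.closure_induction with
  | mem x hx =>
    obtain ⟨w, _, t, ht, rfl⟩ := hx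
    filter_upwards [Filter.eventually_ge_atTop w.length] with c hc
    exact mem_cl v T (by exact hc) ht
  | one => exact Filter.Eventually.of_forall fun c => one_mem _
  | mul x y _ _ h1 h2 => filter_upwards [h1, h2] with c a b using mul_mem a b
  | inv x _ h1 => filter_upwards [h1] with c a using inv_mem a

lemma cl_len_mono (v : β → Γ) (T : Subgroup Γ) {m n : ℕ} (h : m ≤ n) :
    cl v T {w | w.length ≤ m} ≤ cl v T {w | w.length ≤ n} :=
  cl_mono v T (fun _ hw => le_trans hw h)

lemma conj_wv_cl (v : β → Γ) (T : Subgroup Γ) (w : List β) (m : ℕ) :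
    ∀ x ∈ cl v T {u | u.length ≤ m}, wv v w * x * (wv v w)⁻¹ ∈ cl v T {u | u.length ≤ m + w.length} := by
  apply conj_closure
  rintro _ ⟨w', hw', t, ht, rfl⟩
  have : w' ∈ {w : List β | w.length ≤ m} := hw'
  simp only [Set.mem_ofPred_eq] at this
  have := mem_cl v T (W := {u | u.length ≤ m + w.length}) (w := w ++ w') (by simp; omega) ht
  convert this using 1
  rw [wv_append]; group

lemma conj_tau (v : β → Γ) (T : Subgroup Γ) (τ : Γ) (c : ℕ)
    (h1 : ∀ t ∈ T, τ * t * τ⁻¹ ∈ cl v T {w | w.length ≤ c})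
    (h2 : ∀ b, (v b)⁻¹ * τ * v b * τ⁻¹ ∈ cl v T {w | w.length ≤ c}) (m : ℕ) :
    ∀ x ∈ cl v T {w | w.length ≤ m}, τ * x * τ⁻¹ ∈ cl v T {w | w.length ≤ c + m} := by
  have hb : ∀ b, τ * v b * τ⁻¹ * (v b)⁻¹ ∈ cl v T {w | w.length ≤ c + 1} := by
    intro b
    have := conj_wv_cl v T [b] c _ (h2 b)
    simp only [wv_cons, wv_nil, mul_one, List.length_singleton] at this
    convert this using 1
    group
  have hw : ∀ w : List β, τ * wv v w * τ⁻¹ * (wv v w)⁻¹ ∈ cl v T {u | u.length ≤ c + w.length} := by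
    intro w
    induction w with
    | nil => simp
    | cons b w ih =>
      have e : τ * wv v (b :: w) * τ⁻¹ * (wv v (b :: w))⁻¹ = (τ * v b * τ⁻¹ * (v b)⁻¹) *
          (v b * (τ * wv v w * τ⁻¹ * (wv v w)⁻¹) * (v b)⁻¹) := by
        rw [wv_cons]; group
      rw [e]
      have h3 := conj_wv_cl v T [b] _ _ ih
      simp only [wv_cons, wv_nil, mul_one, List.length_singleton] at h3
      refine mul_mem (cl_len_mono v T (by simp) (hb b)) (cl_len_mono v T (by simp [add_assoc]) h3)
  apply conj_closure
  rintro _ ⟨w, hwm, t, ht, rfl⟩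
  have hwm : w.length ≤ m := hwm
  have e : τ * (wv v w * t * (wv v w)⁻¹) * τ⁻¹ = (τ * wv v w * τ⁻¹ * (wv v w)⁻¹) *
     (wv v w * (τ * t * τ⁻¹) * (wv v w)⁻¹) * (τ * wv v w * τ⁻¹ * (wv v w)⁻¹)⁻¹ := by group
  rw [e]
  have g1 := cl_len_mono v T (show c + w.length ≤ c + m by omega) (hw w)
  have g2 := cl_len_mono v T (show c + w.length ≤ c + m by omega) (conj_wv_cl v T w c _ (h1 t ht))
  exact mul_mem (mul_mem g1 g2) (inv_mem g1)

lemma comm_pow_cl (v : β → Γ) (T : Subgroup Γ) (x : Γ) (b : β) (h : x * v b * x⁻¹ * (v b)⁻¹ ∈ T) (e : ℕ) :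
    x * v b ^ e * x⁻¹ * (v b ^ e)⁻¹ ∈ cl v T {w | w.length ≤ e} := by
  induction e with
  | zero => simp
  | succ e ih =>
    have e1 : x * v b ^ (e + 1) * x⁻¹ * (v b ^ (e + 1))⁻¹ = (x * v b * x⁻¹ * (v b)⁻¹) *
      (v b * (x * v b ^ e * x⁻¹ * (v b ^ e)⁻¹) * (v b)⁻¹) := by
      rw [pow_succ']; group
    rw [e1]
    have h3 := conj_wv_cl v T [b] _ _ ih
    simp only [wv_cons, wv_nil, mul_one, List.length_singleton] at h3
    exact mul_mem (le_cl v T (by simp) h) h3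

lemma cl_inl (v : β → Γ) (T : Subgroup Γ) (W : Set (List β)) :
    cl (fun b => (v b, v b)) (T.map (MonoidHom.inl Γ Γ)) W = (cl v T W).map (MonoidHom.inl Γ Γ) := by
  have hw : ∀ w, wv (fun b => (v b, v b)) w = (wv v w, wv v w) := by
    intro w; induction w with
    | nil => rfl
    | cons b w ih => simp [ih]
  unfold cl
  rw [MonoidHom.map_closure]
  congr 1
  ext x
  constructor
  · rintro ⟨w, hW, _, ⟨t, ht, rfl⟩, rfl⟩
    exact ⟨_, ⟨w, hW, t, ht, rfl⟩, by simp [hw]⟩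
  · rintro ⟨_, ⟨w, hW, t, ht, rfl⟩, rfl⟩
    exact ⟨w, hW, (t, 1), ⟨t, ht, rfl⟩, by simp [hw]⟩

lemma cl_inr (v : β → Γ) (T : Subgroup Γ) (W : Set (List β)) :
    cl (fun b => (v b, v b)) (T.map (MonoidHom.inr Γ Γ)) W = (cl v T W).map (MonoidHom.inr Γ Γ) := by
  have hw : ∀ w, wv (fun b => (v b, v b)) w = (wv v w, wv v w) := by
    intro w; induction w with
    | nil => rfl
    | cons b w ih => simp [ih]
  unfold cl
  rw [MonoidHom.map_closure]
  congr 1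
  ext x
  constructor
  · rintro ⟨w, hW, _, ⟨t, ht, rfl⟩, rfl⟩
    exact ⟨_, ⟨w, hW, t, ht, rfl⟩, by simp [hw]⟩
  · rintro ⟨_, ⟨w, hW, t, ht, rfl⟩, rfl⟩
    exact ⟨w, hW, (1, t), ⟨t, ht, rfl⟩, by simp [hw]⟩
end

set_option maxHeartbeats 1000000 in
theorem lemG4 {G β ι : Type*} [Group G] (hfp : FinitelyPresentedGroup G) (N : Subgroup G) [hN : N.Normal]
    (hc : commutator G ≤ N) [Fintype β] [DecidableEq β] [Finite ι] (inv : β → β) (v : β → G)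
    (hinv : ∀ b, v (inv b) = (v b)⁻¹) (n : ι → G)
    (hNcl : cl v (Subgroup.closure (Set.range n)) Set.univ = N)
    (hcm : ∀ b b', v b * v b' * (v b)⁻¹ * (v b')⁻¹ ∈ Subgroup.closure (Set.range n)) (τ : β → G)
    (hμ : ∀ e : ℕ, ∃ μ : (G ⧸ N) ≃* (G ⧸ N), (∀ b, μ (QuotientGroup.mk (v b)) = QuotientGroup.mk (v b)) ∧
      ∀ b, μ (QuotientGroup.mk (τ b * v b ^ e)) = QuotientGroup.mk (τ b)) :
    ∃ μ : (G ⧸ N) ≃* (G ⧸ N), FinitelyPresentedGroup ↥(fibreProduct N N μ) := by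
  set N0 := Subgroup.closure (Set.range n) with hN0
  have hcomm : ∀ x y : G, x * y * x⁻¹ * y⁻¹ ∈ N := fun x y =>
    hc (Subgroup.commutator_mem_commutator (Subgroup.mem_top x) (Subgroup.mem_top y))
  have hN0N : N0 ≤ N := by rw [← hNcl]; exact le_cl v N0 (Set.mem_univ _)
  have hnN : ∀ i, n i ∈ N := fun i => hN0N (Subgroup.subset_closure ⟨i, rfl⟩)
  have ev1 : ∀ᶠ c : ℕ in Filter.atTop, ∀ b i, τ b * n i * (τ b)⁻¹ ∈ cl v N0 {w | w.length ≤ c} := by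
    simp only [Filter.eventually_all]
    intro b i
    exact mem_cl_le v N0 (by rw [hNcl]; exact hN.conj_mem _ (hnN i) _)
  have ev2 : ∀ᶠ c : ℕ in Filter.atTop, ∀ b b', (v b')⁻¹ * τ b * v b' * (τ b)⁻¹ ∈ cl v N0 {w | w.length ≤ c} := by
    simp only [Filter.eventually_all]
    intro b b'
    refine mem_cl_le v N0 ?_
    rw [hNcl]
    simpa using hcomm (v b')⁻¹ (τ b)
  obtain ⟨c, hc1, hc2⟩ := (ev1.and ev2).exists
  have hc1' : ∀ b, ∀ t ∈ N0, τ b * t * (τ b)⁻¹ ∈ cl v N0 {w | w.length ≤ c} := fun b =>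
    conj_closure (by rintro _ ⟨i, rfl⟩; exact hc1 b i)
  set e := 2 * c + 1 with he
  obtain ⟨μ, hμ1, hμ2⟩ := hμ e
  refine ⟨μ, ?_⟩
  have hE := lemE hfp N hc μ
  set P := fibreProduct N N μ with hP
  obtain ⟨m, ϕ, K1, K2, hϕ, n1, n2, f1, f2, k2, k1, T, hTf, hTs, hT⟩ := hE
  have hPm : ∀ a b : G, (a, b) ∈ P ↔ μ (QuotientGroup.mk a) = QuotientGroup.mk b := fun _ _ => Iff.rfl
  have hl : ∀ a ∈ N, ((a, 1) : G × G) ∈ P := by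
    intro a ha
    rw [hPm, (QuotientGroup.eq_one_iff (N := N) a).2 ha]; simp
  have hr : ∀ a, a ∈ N ↔ ((1, a) : G × G) ∈ P := by
    intro a
    rw [hPm, ← QuotientGroup.eq_one_iff]
    simp [eq_comm]
  have hl' : ∀ a, ((a, 1) : G × G) ∈ P → a ∈ N := by
    intro a ha
    rw [hPm] at ha
    rw [← QuotientGroup.eq_one_iff]
    simpa using ha
  let V : β → P := fun b => ⟨(v b, v b), hμ1 b⟩
  let UL : ι → P := fun i => ⟨(n i, 1), hl _ (hnN i)⟩
  let UR : ι → P := fun i => ⟨(1, n i), (hr _).1 (hnN i)⟩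
  let Κ : β → P := fun b => ⟨(τ b * v b ^ e, τ b), hμ2 b⟩
  set L := Subgroup.closure (Set.range UL) with hL
  set R := Subgroup.closure (Set.range UR) with hR
  have hLmap : L.map P.subtype = N0.map (MonoidHom.inl G G) := by
    rw [hL, hN0, hmap, hmap]; rfl
  have hRmap : R.map P.subtype = N0.map (MonoidHom.inr G G) := by
    rw [hR, hN0, hmap, hmap]; rfl
  have memcast : ∀ (M : Subgroup P) (y : P), y ∈ M ↔ (y : G × G) ∈ M.map P.subtype := by
    intro M y
    constructor
    · intro hy; exact ⟨y, hy, rfl⟩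
    · rintro ⟨z, hz, hzy⟩
      rwa [← Subtype.ext (a1 := z) (a2 := y) hzy]
  have memL : ∀ W (y : P), y ∈ cl V L W ↔ ∃ x ∈ cl v N0 W, (x, 1) = (y : G × G) := by
    intro W y
    rw [memcast, cl_map, hLmap]
    have : (P.subtype ∘ V) = fun b => (v b, v b) := rfl
    rw [this, cl_inl]
    rfl
  have memR : ∀ W (y : P), y ∈ cl V R W ↔ ∃ x ∈ cl v N0 W, (1, x) = (y : G × G) := by
    intro W y
    rw [memcast, cl_map, hRmap]
    have : (P.subtype ∘ V) = fun b => (v b, v b) := rfl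
    rw [this, cl_inr]
    rfl
  have memL0 : ∀ (y : P), y ∈ L ↔ ∃ x ∈ N0, (x, 1) = (y : G × G) := by
    intro y
    rw [memcast, hLmap]; rfl
  have memR0 : ∀ (y : P), y ∈ R ↔ ∃ x ∈ N0, (1, x) = (y : G × G) := by
    intro y
    rw [memcast, hRmap]; rfl
  have hclN : ∀ W, cl v N0 W ≤ N := fun W => by
    rw [← hNcl]; exact cl_mono v N0 (Set.subset_univ _)
  -- split an element
  have split : ∀ (y z : P) (lx rx : G) (W W' : Set (List β)), lx ∈ cl v N0 W → rx ∈ cl v N0 W' →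
      (y : G × G) = (z.1.1 * lx, z.1.2 * rx) → ∃ l ∈ cl V L W, ∃ r ∈ cl V R W', y = z * l * r := by
    intro y z lx rx W W' h1 h2 h
    refine ⟨⟨(lx, 1), hl _ (hclN _ h1)⟩, (memL _ _).2 ⟨lx, h1, rfl⟩, ⟨(1, rx), (hr _).1 (hclN _ h2)⟩,
      (memR _ _).2 ⟨rx, h2, rfl⟩, ?_⟩
    apply Subtype.ext
    rw [h]
    ext <;> simp
  choose val hval using fun b => hϕ (V b)
  choose ul hul using fun i => hϕ (UL i)
  choose ur hur using fun i => hϕ (UR i)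
  choose κ hκ using fun b => hϕ (Κ b)
  have hfin : ϕ.ker.IsFinitelyNormallyGenerated := by
    refine lemF ϕ K1 K2 n1 n2 f1 f2 T hTf hTs hT val ul ur κ inv V (by simp only [hval])
      ?hinv L R (by simp only [hul, hL]) (by simp only [hur, hR]) c e (by omega) ?hsw ?h1 ?h2 ?h3 ?h3' ?h0 ?hUL ?hUR ?hg ?hk2 ?hk1
    case hinv =>
      intro b
      apply Subtype.ext
      simp [V, hinv]
    case hsw =>
      intro b b'
      have h := hcm b b'
      refine ⟨⟨(_, 1), hl _ (hN0N h)⟩, (memL0 _).2 ⟨_, h, rfl⟩, ⟨(1, _), (hr _).1 (hN0N h)⟩,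
        (memR0 _).2 ⟨_, h, rfl⟩, ?_⟩
      apply Subtype.ext
      ext <;> simp [V]
    case h1 =>
      intro b l hl1
      obtain ⟨x, hx, hxl⟩ := (memL0 _).1 hl1
      rw [memL]
      refine ⟨_, hc1' b x hx, ?_⟩
      simp only [hκ, Κ, V, Subgroup.coe_mul, Subgroup.coe_inv, Subgroup.coe_pow, ← hxl]
      ext <;> simp
    case h2 =>
      intro b l hl1
      obtain ⟨x, hx, hxl⟩ := (memR0 _).1 hl1
      rw [memR]
      refine ⟨_, hc1' b x hx, ?_⟩
      simp only [hκ, Κ, V, Subgroup.coe_mul, Subgroup.coe_inv, Subgroup.coe_pow, ← hxl]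
      ext <;> simp
    case h3 =>
      intro b b'
      refine split _ _ ((v b')⁻¹ * τ b * v b' * (τ b)⁻¹ * (τ b * ((v b')⁻¹ * v b ^ e * v b' * (v b ^ e)⁻¹) * (τ b)⁻¹))
        ((v b')⁻¹ * τ b * v b' * (τ b)⁻¹) _ _ ?_ (hc2 b b') ?_
      · refine mul_mem (cl_len_mono v N0 (by omega) (hc2 b b')) ?_
        refine conj_tau v N0 (τ b) c (hc1' b) (hc2 b) e _ ?_
        have := comm_pow_cl v N0 (v b')⁻¹ b (by rw [← hinv]; exact hcm _ _) e
        simpa using this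
      · simp only [hκ, Κ, V, Subgroup.coe_mul, Subgroup.coe_inv]
        ext
        · simp [mul_assoc]
        · simp [mul_assoc]
    case h3' =>
      intro b
      refine split _ _ ((v b)⁻¹ * τ b * v b * (τ b)⁻¹) ((v b)⁻¹ * τ b * v b * (τ b)⁻¹) _ _ (hc2 b b) (hc2 b b) ?_
      simp only [hκ, Κ, V, Subgroup.coe_mul, Subgroup.coe_inv]
      have hpow : v b ^ e * v b = v b * v b ^ e := (pow_mul_comm' (v b) e)
      ext
      · simp only [Prod.fst_mul, Prod.fst_inv]
        rw [mul_assoc (τ b), hpow]; group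
      · simp [mul_assoc]
    case h0 =>
      intro l hl1 r hr1
      obtain ⟨x, hx, hxl⟩ := (memL _ _).1 hl1
      obtain ⟨y, hy, hyr⟩ := (memR _ _).1 hr1
      apply Subtype.ext
      rw [Subgroup.coe_mul, Subgroup.coe_mul, ← hxl, ← hyr]
      simp
    case hUL =>
      constructor
      intro l hl1 g
      obtain ⟨x, hx, hxl⟩ := (memL _ _).1 hl1
      rw [memL]
      refine ⟨g.1.1 * x * g.1.1⁻¹, ?_, ?_⟩
      · rw [hNcl] at hx ⊢; exact hN.conj_mem _ hx _
      · rw [Subgroup.coe_mul, Subgroup.coe_mul, ← hxl]; ext <;> simp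
    case hUR =>
      constructor
      intro l hl1 g
      obtain ⟨x, hx, hxl⟩ := (memR _ _).1 hl1
      rw [memR]
      refine ⟨g.1.2 * x * g.1.2⁻¹, ?_, ?_⟩
      · rw [hNcl] at hx ⊢; exact hN.conj_mem _ hx _
      · rw [Subgroup.coe_mul, Subgroup.coe_mul, ← hxl]; ext <;> simp
    case hg =>
      intro g b
      refine split _ _ ((v b)⁻¹ * g.1.1 * v b * g.1.1⁻¹) ((v b)⁻¹ * g.1.2 * v b * g.1.2⁻¹) _ _ ?_ ?_ ?_
      · rw [hNcl]; simpa using hcomm (v b)⁻¹ g.1.1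
      · rw [hNcl]; simpa using hcomm (v b)⁻¹ g.1.2
      · ext <;> simp [V, mul_assoc]
    case hk2 =>
      rintro _ ⟨x, hx, rfl⟩
      rw [memL, hNcl]
      have h := k2 x hx
      have e1 : ((ϕ x : P) : G × G) = ((ϕ x).1.1, 1) := by rw [← h]
      refine ⟨(ϕ x).1.1, hl' _ ?_, e1.symm⟩
      rw [← e1]; exact (ϕ x).2
    case hk1 =>
      rintro _ ⟨x, hx, rfl⟩
      rw [memR, hNcl]
      have h := k1 x hx
      have e1 : ((ϕ x : P) : G × G) = (1, (ϕ x).1.2) := by rw [← h]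
      refine ⟨(ϕ x).1.2, (hr _).2 ?_, e1.symm⟩
      rw [← e1]; exact (ϕ x).2
  obtain ⟨S, hSf, hS⟩ := hfin
  exact ⟨m, ϕ, hSf.toFinset, hϕ, by rw [← hS]; simp⟩

/-- letters `a_i^{±1}` -/
def lett {Λ : Type*} [Group Λ] {s : ℕ} (a : Fin s → Λ) (b : Fin s × Bool) : Λ :=
  if b.2 then a b.1 else (a b.1)⁻¹

/-- inverse letter -/
def linv {s : ℕ} (b : Fin s × Bool) : Fin s × Bool := (b.1, !b.2)

lemma lett_linv {Λ : Type*} [Group Λ] {s : ℕ} (a : Fin s → Λ) (b : Fin s × Bool) :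
    lett a (linv b) = (lett a b)⁻¹ := by
  rcases b with ⟨i, _ | _⟩ <;> simp [lett, linv]

theorem lemG3 {Λ : Type*} [Group Λ] [hfg : Group.FG Λ] (N : Subgroup Λ) [hN : N.Normal]
    (hc : commutator Λ ≤ N) {s : ℕ} (a : Fin s → Λ)
    (htop : N ⊔ Subgroup.closure (Set.range a) = ⊤) (χ : Fin s → Λ →* Multiplicative ℤ)
    (hχN : ∀ i, N ≤ (χ i).ker)
    (hχ : ∀ i j, χ i (a j) = if i = j then Multiplicative.ofAdd 1 else 1) :
    ∃ S : Set Λ, S.Finite ∧ cl (lett a) (Subgroup.closure S) Set.univ = N ∧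
      ∀ b b', lett a b * lett a b' * (lett a b)⁻¹ * (lett a b')⁻¹ ∈ Subgroup.closure S := by
  obtain ⟨X, hX⟩ := hfg.out
  have hdec : ∀ x : Λ, ∃ n ∈ N, ∃ y ∈ Subgroup.closure (Set.range a), n * y = x := by
    intro x
    have : x ∈ N ⊔ Subgroup.closure (Set.range a) := by rw [htop]; trivial
    exact Subgroup.mem_sup_of_normal_left.1 this
  choose ν hνN y hy hνy using hdec
  set cm : (Fin s × Bool) × (Fin s × Bool) → Λ := fun p =>
    lett a p.1 * lett a p.2 * (lett a p.1)⁻¹ * (lett a p.2)⁻¹ with hcm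
  have hcomm : ∀ x y : Λ, x * y * x⁻¹ * y⁻¹ ∈ N := fun x y =>
    hc (Subgroup.commutator_mem_commutator (Subgroup.mem_top x) (Subgroup.mem_top y))
  set S : Set Λ := ν '' (X : Set Λ) ∪ Set.range cm with hS
  have hSf : S.Finite := (X.finite_toSet.image _).union (Set.finite_range _)
  have hSN : Subgroup.closure S ≤ N := by
    rw [Subgroup.closure_le]
    rintro _ (⟨x, _, rfl⟩ | ⟨p, rfl⟩)
    · exact hνN x
    · exact hcomm _ _
  refine ⟨S, hSf, ?_, fun b b' => Subgroup.subset_closure (Or.inr ⟨(b, b'), rfl⟩)⟩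
  set U := cl (lett a) (Subgroup.closure S) Set.univ with hU
  have hSU : S ⊆ U := fun x hx => le_cl (lett a) _ (Set.mem_univ _) (Subgroup.subset_closure hx)
  have hUN : U ≤ N := by
    rw [hU, cl, Subgroup.closure_le]
    rintro _ ⟨w, _, t, ht, rfl⟩
    exact hN.conj_mem _ (hSN ht) _
  have hv1 : ∀ b, ∀ h ∈ U, lett a b * h * (lett a b)⁻¹ ∈ U := by
    intro b
    apply conj_closure
    rintro _ ⟨w, _, t, ht, rfl⟩
    have := mem_cl (lett a) (Subgroup.closure S) (W := Set.univ) (w := b :: w) (Set.mem_univ _) ht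
    simpa [mul_assoc] using this
  have hv : ∀ b, lett a b ∈ Subgroup.normalizer (U : Set Λ) := by
    intro b
    refine mem_normalizer_of U _ (hv1 b) ?_
    intro h hh
    have := hv1 (linv b) h hh
    simpa [lett_linv] using this
  have htop2 : U ⊔ Subgroup.closure (Set.range a) = ⊤ := by
    rw [eq_top_iff, ← hX, Subgroup.closure_le]
    intro x hx
    rw [← hνy x]
    exact Subgroup.mul_mem_sup (hSU (Or.inl ⟨x, hx, rfl⟩)) (hy x)
  have hUn : U.Normal := by
    rw [← Subgroup.normalizer_eq_top_iff, eq_top_iff, ← htop2]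
    refine sup_le Subgroup.le_normalizer ?_
    rw [Subgroup.closure_le]
    rintro _ ⟨i, rfl⟩
    have := hv (i, true)
    simpa [lett] using this
  have hgen : ∀ q : Λ ⧸ U, q ∈ Subgroup.closure (Set.range fun i => QuotientGroup.mk' U (a i)) := by
    intro q
    obtain ⟨x, rfl⟩ := QuotientGroup.mk'_surjective U q
    have : x ∈ U ⊔ Subgroup.closure (Set.range a) := by rw [htop2]; trivial
    obtain ⟨u, hu, z, hz, rfl⟩ := Subgroup.mem_sup_of_normal_left.1 this
    rw [map_mul]
    have : QuotientGroup.mk' U u = 1 := (QuotientGroup.eq_one_iff u).2 hu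
    rw [this, one_mul, ← hmap]
    exact ⟨z, hz, rfl⟩
  have hcq : ∀ p q : Λ ⧸ U, p * q = q * p := by
    intro p q
    refine commute_closure ?_ (hgen p) (hgen q)
    rintro _ ⟨i, rfl⟩ _ ⟨j, rfl⟩
    have h : a i * a j * (a i)⁻¹ * (a j)⁻¹ ∈ U := hSU (Or.inr ⟨((i, true), (j, true)), by simp [hcm, lett]⟩)
    have h2 : QuotientGroup.mk' U (a i * a j * (a i)⁻¹ * (a j)⁻¹) = 1 := (QuotientGroup.eq_one_iff _).2 h
    simp only [map_mul, map_inv] at h2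
    show _ * _ = _ * _
    rw [mul_inv_eq_one, mul_inv_eq_iff_eq_mul] at h2
    exact h2
  let _ : CommGroup (Λ ⧸ U) := { (inferInstance : Group (Λ ⧸ U)) with mul_comm := hcq }
  let h2 : Λ →* Λ ⧸ U := ∏ i, (zpowersHom (Λ ⧸ U) (QuotientGroup.mk' U (a i))).comp (χ i)
  have h2a : ∀ x, h2 x = ∏ i, (QuotientGroup.mk' U (a i)) ^ (Multiplicative.toAdd (χ i x)) := by
    intro x
    simp [h2, MonoidHom.finsetProd_apply]
  have heq : Set.EqOn (QuotientGroup.mk' U) h2 (Subgroup.closure (Set.range a)) := by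
    apply MonoidHom.eqOn_closure
    rintro _ ⟨j, rfl⟩
    rw [h2a, Finset.prod_eq_single j]
    · simp [hχ]
    · intro i _ hij
      simp [hχ, hij]
    · simp
  refine le_antisymm hUN ?_
  intro g hg
  have : g ∈ U ⊔ Subgroup.closure (Set.range a) := by rw [htop2]; trivial
  obtain ⟨u, hu, z, hz, rfl⟩ := Subgroup.mem_sup_of_normal_left.1 this
  have hzN : z ∈ N := (Subgroup.mul_mem_cancel_left _ (hUN hu)).1 hg
  refine mul_mem hu ?_
  have h3 := heq hz
  rw [h2a, Finset.prod_eq_one] at h3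
  · exact (QuotientGroup.eq_one_iff z).1 h3
  · intro i _
    have : χ i z = 1 := hχN i hzN
    simp [this]

lemma fgz_basis {M : Type*} [AddCommGroup M] [Module.Finite ℤ M] :
    ∃ (a : Fin (Module.finrank ℤ M) → M) (χ : Fin (Module.finrank ℤ M) → M →ₗ[ℤ] ℤ),
      (∀ i j, χ i (a j) = if i = j then 1 else 0) ∧ Finite (M ⧸ Submodule.span ℤ (Set.range a)) := by
  set T := Submodule.torsion ℤ M with hT
  have hr : Module.finrank ℤ (M ⧸ T) = Module.finrank ℤ M :=
    finrank_quotient_eq_of_le_torsion le_rfl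
  have : Module.Free ℤ (M ⧸ T) := inferInstance
  let b : Module.Basis (Fin (Module.finrank ℤ M)) ℤ (M ⧸ T) := Module.finBasisOfFinrankEq ℤ _ hr
  choose a ha using fun i => T.mkQ_surjective (b i)
  refine ⟨a, fun i => (b.coord i).comp T.mkQ, ?_, ?_⟩
  · intro i j
    simp only [LinearMap.comp_apply, ha]
    simp [Finsupp.single_apply, eq_comm]
  · have : Module.IsTorsion ℤ (M ⧸ Submodule.span ℤ (Set.range a)) := by
      intro x
      obtain ⟨x, rfl⟩ := Submodule.mkQ_surjective _ x
      have h1 : x - ∑ i, b.repr (T.mkQ x) i • a i ∈ T := by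
        refine (Submodule.Quotient.mk_eq_zero T).1 ?_
        change T.mkQ _ = 0
        rw [map_sub, map_sum]
        simp only [map_smul, ha]
        rw [b.sum_repr, sub_self]
      obtain ⟨k, hk⟩ := (Submodule.mem_torsion_iff _).1 h1
      refine ⟨k, ?_⟩
      have h2 : (k : ℤ) • x = (k : ℤ) • ∑ i, b.repr (T.mkQ x) i • a i := by
        rw [← sub_eq_zero, ← smul_sub]; exact hk
      show (k : ℤ) • (Submodule.span ℤ (Set.range a)).mkQ x = 0
      rw [← map_smul, h2, ← LinearMap.mem_ker, Submodule.ker_mkQ]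
      refine Submodule.smul_mem _ _ (Submodule.sum_mem _ fun i _ => Submodule.smul_mem _ _ (Submodule.subset_span ⟨i, rfl⟩))
    exact Module.finite_of_fg_torsion _ this

theorem lemG1 {V : Type*} [AddCommGroup V] [Module.Finite ℤ V] (A : Submodule ℤ V)
    (h : Module.finrank ℤ A ≤ Module.finrank ℤ (V ⧸ A)) :
    ∃ (s : ℕ) (a : Fin s → A) (χ : Fin s → A →ₗ[ℤ] ℤ),
      (∀ i j, χ i (a j) = if i = j then 1 else 0) ∧ Finite (A ⧸ Submodule.span ℤ (Set.range a)) ∧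
      ∃ (t : Fin s → V) (ψ : Fin s → V →ₗ[ℤ] ℤ), (∀ i, ∀ x ∈ A, ψ i x = 0) ∧
        ∀ i j, ψ i (t j) = if i = j then 1 else 0 := by
  obtain ⟨a, χ, h1, h2⟩ := fgz_basis (M := A)
  obtain ⟨t, ψ, h3, -⟩ := fgz_basis (M := V ⧸ A)
  choose t' ht' using fun i => A.mkQ_surjective (t i)
  refine ⟨_, a, χ, h1, h2, fun i => t' (Fin.castLE h i), fun i => (ψ (Fin.castLE h i)).comp A.mkQ, ?_, ?_⟩
  · intro i x hx
    have : A.mkQ x = 0 := by rw [← LinearMap.mem_ker, Submodule.ker_mkQ]; exact hx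
    rw [LinearMap.comp_apply, this, map_zero]
  · intro i j
    rw [LinearMap.comp_apply, ht', h3]
    simp

theorem lemMu {Q : Type*} [CommGroup Q] {s : ℕ} (a t : Fin s → Q) (ψ : Fin s → Q →* Multiplicative ℤ)
    (ha : ∀ i j, ψ i (a j) = 1) (ht : ∀ i j, ψ i (t j) = if i = j then Multiplicative.ofAdd 1 else 1)
    (e : ℕ) : ∃ μ : Q ≃* Q, (∀ b, μ (lett a b) = lett a b) ∧
      ∀ b, μ ((lett t b)⁻¹ * lett a b ^ e) = (lett t b)⁻¹ := by
  let δ : Q →* Q := ∏ i, (zpowersHom Q (a i ^ e)).comp (ψ i)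
  have hδ : ∀ x, δ x = ∏ i, (a i ^ e) ^ (Multiplicative.toAdd (ψ i x)) := by
    intro x
    simp [δ, MonoidHom.finsetProd_apply]
  have hδa : ∀ j, δ (a j) = 1 := by
    intro j
    rw [hδ]
    simp [ha]
  have hδt : ∀ j, δ (t j) = a j ^ e := by
    intro j
    rw [hδ, Finset.prod_eq_single j]
    · simp [ht]
    · intro i _ hij
      simp [ht, hij]
    · simp
  have hδδ : ∀ x, δ (δ x) = 1 := by
    intro x
    rw [hδ x]
    simp [map_prod, hδa]
  have hla : ∀ b, δ (lett a b) = 1 := by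
    rintro ⟨i, _ | _⟩ <;> simp [lett, hδa]
  have hlt : ∀ b, δ (lett t b) = lett a b ^ e := by
    rintro ⟨i, _ | _⟩ <;> simp [lett, hδt]
  refine ⟨{ toFun := fun q => q * δ q, invFun := fun q => q * (δ q)⁻¹, left_inv := ?_, right_inv := ?_,
                map_mul' := ?_ }, ?_, ?_⟩
  · intro q; simp [hδδ]
  · intro q; simp [hδδ]
  · intro x y; simp only [map_mul]; exact mul_mul_mul_comm _ _ _ _
  · intro b; simp [hla]
  · intro b; simp [hla, hlt]

theorem final {G : Type*} [Group G]
    (hfp : FinitelyPresentedGroup G)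
    (N : Subgroup G) [hN : N.Normal] (hc : commutator G ≤ N)
    (H : Subgroup G) (hHn : H.Normal) (hNH : N ≤ H) (hHfg : H.FG)
    (hrk : rkQuot N hN ≤ 2 * rkQuot H hHn) :
    ∃ μ : (G ⧸ N) ≃* (G ⧸ N), FinitelyPresentedGroup ↥(fibreProduct N N μ) := by
  have hGfg : Group.FG G := by
    obtain ⟨m, f, S, hf, -⟩ := hfp
    exact Group.fg_of_surjective hf
  have hkerK : ∀ (K : Subgroup G) [K.Normal], N ≤ K → ∀ g : G,
      Abelianization.of (QuotientGroup.mk' K g) = 1 ↔ g ∈ K := by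
    intro K _ hNK g
    rw [← MonoidHom.mem_ker, Abelianization.ker_of]
    have : commutator (G ⧸ K) = ⊥ := by
      rw [commutator_def, ← Subgroup.map_top_of_surjective _ (QuotientGroup.mk'_surjective K),
        ← Subgroup.map_commutator, Subgroup.map_eq_bot_iff, QuotientGroup.ker_mk']
      exact hc.trans hNK
    rw [this, Subgroup.mem_bot]
    exact QuotientGroup.eq_one_iff g
  let π : G →* Abelianization (G ⧸ N) := Abelianization.of.comp (QuotientGroup.mk' N)
  have hπs : Function.Surjective π := by
    intro x
    obtain ⟨y, rfl⟩ := QuotientGroup.mk_surjective x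
    obtain ⟨g, rfl⟩ := QuotientGroup.mk_surjective y
    exact ⟨g, rfl⟩
  have hπk : ∀ g, π g = 1 ↔ g ∈ N := hkerK N le_rfl
  have hπe : ∀ K : Subgroup G, N ≤ K → ∀ g, π g ∈ K.map π → g ∈ K := by
    rintro K hK g ⟨k, hk, hkg⟩
    have : g * k⁻¹ ∈ N := by rw [← hπk, map_mul, map_inv, hkg, mul_inv_cancel]
    have h2 := mul_mem (hK this) hk
    simpa using h2
  let V := Additive (Abelianization (G ⧸ N))
  have hVfg : Group.FG (Abelianization (G ⧸ N)) := Group.fg_of_surjective hπs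
  have hVa : AddGroup.FG V := inferInstance
  have hVfin : Module.Finite ℤ V := Module.Finite.iff_addGroup_fg.2 hVa
  let sm : Subgroup G → Submodule ℤ V := fun K => AddSubgroup.toIntSubmodule (Subgroup.toAddSubgroup (K.map π))
  have hsm : ∀ K (x : V), x ∈ sm K ↔ x.toMul ∈ K.map π := fun K x => Iff.rfl
  let A := sm H
  have hquot : Module.finrank ℤ (V ⧸ A) = rkQuot H hHn := by
    let f0 : Abelianization (G ⧸ N) →* Abelianization (G ⧸ H) :=
      Abelianization.map (QuotientGroup.map N H (MonoidHom.id G) hNH)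
    have hf0 : ∀ g, f0 (π g) = Abelianization.of (QuotientGroup.mk' H g) := fun g => rfl
    let f : V →ₗ[ℤ] Additive (Abelianization (G ⧸ H)) := (MonoidHom.toAdditive f0).toIntLinearMap
    have hfs : Function.Surjective f := by
      intro x
      obtain ⟨y, hy⟩ := QuotientGroup.mk_surjective x.toMul
      obtain ⟨g, rfl⟩ := QuotientGroup.mk_surjective y
      exact ⟨Additive.ofMul (π g), hy⟩
    have hfk : LinearMap.ker f = A := by
      ext x
      obtain ⟨g, hg⟩ := hπs x.toMul
      have e1 : x ∈ LinearMap.ker f ↔ f0 x.toMul = 1 := Iff.rfl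
      rw [e1, hsm, ← hg, hf0, hkerK H hNH]
      exact ⟨fun h => ⟨g, h, rfl⟩, hπe H hNH g⟩
    have e2 := (LinearMap.quotKerEquivOfSurjective f hfs).finrank_eq
    rw [hfk] at e2
    exact e2
  have hle : Module.finrank ℤ A ≤ Module.finrank ℤ (V ⧸ A) := by
    have h1 := Submodule.finrank_quotient_add_finrank A
    have h2 : Module.finrank ℤ V = rkQuot N hN := rfl
    omega
  obtain ⟨s, a, χ, hχa, hfin, t, ψ, hψA, hψt⟩ := lemG1 A hle
  have hga : ∀ i, ∃ g ∈ H, Additive.ofMul (π g) = (a i : V) := by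
    intro i
    obtain ⟨g, hg, h⟩ := (a i).2
    exact ⟨g, hg, h⟩
  choose ga hgaH hga using hga
  choose gt hgt using fun i => hπs (t i).toMul
  let H' : Subgroup G := N ⊔ Subgroup.closure (Set.range ga)
  have hH'H : H' ≤ H := by
    refine sup_le hNH ?_
    rw [Subgroup.closure_le]
    rintro _ ⟨i, rfl⟩
    exact hgaH i
  have hNH' : N ≤ H' := le_sup_left
  have hgaH' : ∀ i, ga i ∈ H' := fun i => (le_sup_right : _ ≤ H') (Subgroup.subset_closure ⟨i, rfl⟩)
  let toA : H →* Multiplicative A := MonoidHom.mk'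
    (fun h => Multiplicative.ofAdd ⟨Additive.ofMul (π h.1), ⟨h.1, h.2, rfl⟩⟩)
    (by intro x y; apply Multiplicative.toAdd.injective; apply Subtype.ext; simp)
  have htoA : ∀ h : H, ((Multiplicative.toAdd (toA h) : A) : V) = Additive.ofMul (π h.1) := fun _ => rfl
  have htoAa : ∀ i, Multiplicative.toAdd (toA ⟨ga i, hgaH i⟩) = a i := fun i => Subtype.ext (hga i)
  have hH'fg : Group.FG H' := by
    let M := Submodule.span ℤ (Set.range a)
    let θ : H →* Multiplicative (A ⧸ M) := (AddMonoidHom.toMultiplicative M.mkQ.toAddMonoidHom).comp toA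
    have hfin2 : Finite (Multiplicative (A ⧸ M)) := hfin
    have hk : θ.ker ≤ H'.subgroupOf H := by
      intro h hh
      have h1 : M.mkQ (Multiplicative.toAdd (toA h)) = 0 := hh
      rw [← LinearMap.mem_ker, Submodule.ker_mkQ] at h1
      have h2 : M ≤ (sm H').comap A.subtype := by
        rw [Submodule.span_le]
        rintro _ ⟨i, rfl⟩
        exact ⟨ga i, hgaH' i, hga i⟩
      exact hπe H' hNH' h.1 (h2 h1)
    have : θ.ker.FiniteIndex := inferInstance
    have : (H'.subgroupOf H).FiniteIndex := Subgroup.finiteIndex_of_le hk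
    have : Group.FG H := (Group.fg_iff_subgroup_fg H).2 hHfg
    have h3 : Group.FG (H'.subgroupOf H) := inferInstance
    exact Group.fg_of_surjective (f := (Subgroup.subgroupOfEquivOfLe hH'H).toMonoidHom) (MulEquiv.surjective _)
  have hcomm : ∀ x y : G, x * y * x⁻¹ * y⁻¹ ∈ N := fun x y =>
    hc (Subgroup.commutator_mem_commutator (Subgroup.mem_top x) (Subgroup.mem_top y))
  obtain ⟨S, hSf, hScl, hScm⟩ := lemG3 (Λ := H') (N.subgroupOf H') (by
      rw [commutator_def, Subgroup.commutator_le]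
      intro x _ y _
      exact hcomm x.1 y.1) (fun i => ⟨ga i, hgaH' i⟩) (by
      apply Subgroup.map_injective H'.subtype_injective
      rw [Subgroup.map_sup, hmap, Subgroup.map_subgroupOf_eq_of_le hNH', ← MonoidHom.range_eq_map,
        Subgroup.range_subtype]
      rfl) (fun i => (AddMonoidHom.toMultiplicative (χ i).toAddMonoidHom).comp
        (toA.comp (Subgroup.inclusion hH'H))) (by
      intro i x hx
      have h1 : toA (Subgroup.inclusion hH'H x) = 1 := by
        apply Multiplicative.toAdd.injective
        apply Subtype.ext
        rw [htoA]
        exact (hπk x.1).2 hx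
      rw [MonoidHom.mem_ker, MonoidHom.comp_apply, MonoidHom.comp_apply, h1, map_one]) (by
      intro i j
      have h1 : Multiplicative.toAdd (toA (Subgroup.inclusion hH'H ⟨ga j, hgaH' j⟩)) = a j := htoAa j
      show Multiplicative.ofAdd (χ i (Multiplicative.toAdd (toA (Subgroup.inclusion hH'H ⟨ga j, hgaH' j⟩)))) = _
      rw [h1, hχa]
      split_ifs <;> rfl)
  have hlett : H'.subtype ∘ lett (fun i => (⟨ga i, hgaH' i⟩ : H')) = lett ga := by
    funext b
    rcases b with ⟨i, _ | _⟩ <;> simp [lett]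
  have hmapS : (Subgroup.closure S).map H'.subtype = Subgroup.closure (Set.range fun x : S => (x.1.1 : G)) := by
    rw [MonoidHom.map_closure]
    congr 1
    ext x
    constructor
    · rintro ⟨y, hy, rfl⟩; exact ⟨⟨y, hy⟩, rfl⟩
    · rintro ⟨y, rfl⟩; exact ⟨y.1, y.2, rfl⟩
  have : Finite S := hSf
  refine lemG4 hfp N hc linv (lett ga) (lett_linv ga) (fun x : S => (x.1.1 : G)) ?_ ?_
    (fun b => (lett gt b)⁻¹) ?_
  · rw [← hmapS, ← hlett, ← cl_map, hScl, Subgroup.map_subgroupOf_eq_of_le hNH']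
  · intro b b'
    rw [← hmapS, ← hlett]
    exact ⟨_, hScm b b', by simp⟩
  · intro e
    have hcq : ∀ p q : G ⧸ N, p * q = q * p := by
      intro p q
      obtain ⟨x, rfl⟩ := QuotientGroup.mk_surjective p
      obtain ⟨y, rfl⟩ := QuotientGroup.mk_surjective q
      have h2 : QuotientGroup.mk' N (x * y * x⁻¹ * y⁻¹) = 1 := (QuotientGroup.eq_one_iff _).2 (hcomm x y)
      simp only [map_mul, map_inv] at h2
      rw [mul_inv_eq_one, mul_inv_eq_iff_eq_mul] at h2
      exact h2
    let _ : CommGroup (G ⧸ N) := { (inferInstance : Group (G ⧸ N)) with mul_comm := hcq }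
    obtain ⟨μ, h1, h2⟩ := lemMu (Q := G ⧸ N) (fun i => QuotientGroup.mk' N (ga i))
      (fun i => QuotientGroup.mk' N (gt i))
      (fun i => (AddMonoidHom.toMultiplicativeRight (β := ℤ) (ψ i).toAddMonoidHom).comp Abelianization.of) (by
        intro i j
        show Multiplicative.ofAdd (ψ i (Additive.ofMul (π (ga j)))) = 1
        rw [hga, hψA i _ (a j).2]; rfl) (by
        intro i j
        show Multiplicative.ofAdd (ψ i (Additive.ofMul (π (gt j)))) = _
        rw [hgt]
        have := hψt i j
        have e2 : (Additive.ofMul (t j).toMul) = t j := rfl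
        rw [e2, this]
        split_ifs <;> rfl) e
    have hla : ∀ b, lett (fun i => QuotientGroup.mk' N (ga i)) b = QuotientGroup.mk' N (lett ga b) := by
      rintro ⟨i, _ | _⟩ <;> simp [lett]
    have hlt : ∀ b, lett (fun i => QuotientGroup.mk' N (gt i)) b = QuotientGroup.mk' N (lett gt b) := by
      rintro ⟨i, _ | _⟩ <;> simp [lett]
    refine ⟨μ, ?_, ?_⟩
    · intro b
      have := h1 b
      rw [hla] at this
      exact this
    · intro b
      have := h2 b
      rw [hla, hlt] at this
      exact this

end TFP

/-- If `G` is finitely presented, `G' ≤ N ⊴ G`, and there is a finitely generated subgroup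
`N ≤ H ≤ G` with `rk G/N ≤ 2·rk G/H`, then some twisted `N`-fibre product `H_μ ≤ G × G`
is finitely presented. -/
theorem exists_fp_twisted_fibre_product_of_double_rank {G : Type*} [Group G]
    (hfp : FinitelyPresentedGroup G)
    (N : Subgroup G) [hN : N.Normal] (hc : commutator G ≤ N)
    (H : Subgroup G) (hHn : H.Normal) (hNH : N ≤ H) (hHfg : H.FG)
    (hrk : rkQuot N hN ≤ 2 * rkQuot H hHn) :
    ∃ μ : (G ⧸ N) ≃* (G ⧸ N), FinitelyPresentedGroup ↥(fibreProduct N N μ) := by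
  exact TFP.final hfp N hc H hHn hNH hHfg hrk
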